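/- arXiv:math/0210367 — 3 statements merged into one kernel-verified Lean document; each statement's English description precedes it below -/
import Mathlib

section
/- Let L be an affine subspace of ℝ^n and let f = (f_1,...,f_n) be a smooth map from an open subset U of ℝ^d to L which is nondegenerate in L at x_0 ∈ U. Then f (viewed as a map into ℝ^n) is good at x_0. -/
open MeasureTheory

/-- `g` is `(C,α)`-good on `V`: for every open ball `B ⊆ V` and every `ε > 0`,
`|{x ∈ B : |g x| < ε sup_B |g|}| ≤ C ε^α |B|`. -/
def IsGoodOn {d : ℕ} (C α : ℝ) (g : (Fin d → ℝ) → ℝ) (V : Set (Fin d → ℝ)) : Prop :=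
  ∀ (z : Fin d → ℝ) (ρ : ℝ), 0 < ρ → Metric.ball z ρ ⊆ V → ∀ ε : ℝ, 0 < ε →
    volume {x ∈ Metric.ball z ρ |
        |g x| < ε * sSup ((fun y => |g y|) '' Metric.ball z ρ)} ≤
      ENNReal.ofReal (C * ε ^ α) * volume (Metric.ball z ρ)

/-- `f = (f_1,…,f_n)` is good at `x₀ ∈ U`: there are a neighborhood `V ⊆ U` of `x₀` and
`C, α > 0` such that every linear combination `c₀ + c₁f₁ + … + c_nf_n` is `(C,α)`-good
on `V`. -/
def GoodAt {d n : ℕ} (U : Set (Fin d → ℝ)) (f : (Fin d → ℝ) → Fin n → ℝ)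
    (x₀ : Fin d → ℝ) : Prop :=
  ∃ V ∈ nhds x₀, V ⊆ U ∧ ∃ C : ℝ, 0 < C ∧ ∃ α : ℝ, 0 < α ∧
    ∀ (c₀ : ℝ) (c : Fin n → ℝ),
      IsGoodOn C α (fun x => c₀ + ∑ i, c i * f x i) V

/-- `f : U → L` is nondegenerate in `L` at `x`: for some `l`, the partial derivatives of `f`
at `x` of order up to `l` span the linear part of `L`. -/
def NondegAt {d n : ℕ} (U : Set (Fin d → ℝ)) (L : AffineSubspace ℝ (Fin n → ℝ))
    (f : (Fin d → ℝ) → Fin n → ℝ) (x : Fin d → ℝ) : Prop :=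
  ∃ l : ℕ, Submodule.span ℝ
      {y : Fin n → ℝ | ∃ m : ℕ, 1 ≤ m ∧ m ≤ l ∧
        ∃ u : Fin m → (Fin d → ℝ), y = iteratedFDerivWithin ℝ m f U x u} = L.direction

theorem volume_le_of_locally_small {T : Set ℝ} (hT : T ⊆ Set.Icc (-1) 1) {η D : ℝ} (hη : 0 < η)
    (hD : 0 ≤ D) (h : ∀ s ∈ T, ∀ t ∈ T, |s - t| ≤ η → |s - t| ≤ D) :
    volume T ≤ ENNReal.ofReal ((2 / η + 1) * D) := by
  set N := ⌊2 / η⌋₊ + 1 with hN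
  have hcover : T ⊆ ⋃ k ∈ Finset.range N, T ∩ Set.Icc (-1 + k * η) (-1 + (k + 1) * η) := by
    intro t ht
    have h1 := hT ht
    have h0 : 0 ≤ (t + 1) / η := div_nonneg (by linarith [h1.1]) hη.le
    simp only [Set.mem_iUnion, Finset.mem_range]
    refine ⟨⌊(t + 1) / η⌋₊, ?_, ht, ?_, ?_⟩
    · exact Nat.lt_succ_of_le (Nat.floor_le_floor (by gcongr; linarith [h1.2]))
    · have := (le_div_iff₀ hη).1 (Nat.floor_le h0)
      linarith
    · have := (div_lt_iff₀ hη).1 (Nat.lt_floor_add_one ((t + 1) / η))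
      linarith
  calc volume T ≤ ∑ k ∈ Finset.range N, volume (T ∩ Set.Icc (-1 + k * η) (-1 + (k + 1) * η)) :=
        (measure_mono hcover).trans (measure_biUnion_finset_le _ _)
    _ ≤ ∑ k ∈ Finset.range N, ENNReal.ofReal D := by
        refine Finset.sum_le_sum fun k _ => (Real.volume_le_diam _).trans ?_
        refine Metric.ediam_le fun s hs t ht => ?_
        rw [edist_dist, Real.dist_eq]
        refine ENNReal.ofReal_le_ofReal (h s hs.1 t ht.1 ?_)
        rw [abs_le]
        constructor <;> linarith [hs.2.1, hs.2.2, ht.2.1, ht.2.2]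
    _ = ENNReal.ofReal (N * D) := by
        rw [Finset.sum_const, Finset.card_range, nsmul_eq_mul, ENNReal.ofReal_mul (by positivity),
          ENNReal.ofReal_natCast]
    _ ≤ _ := by
        refine ENNReal.ofReal_le_ofReal (mul_le_mul_of_nonneg_right ?_ hD)
        rw [hN]; push_cast
        linarith [Nat.floor_le (show 0 ≤ 2 / η by positivity)]

theorem measure_le_of_slices {E : Type*} [NormedAddCommGroup E] [NormedSpace ℝ E]
    [MeasurableSpace E] [BorelSpace E] [FiniteDimensional ℝ E]
    (μ : Measure E) [μ.IsAddHaarMeasure] {A : Set E} (hA : MeasurableSet A)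
    (hAB : A ⊆ Metric.ball 0 1) {v : E} (hv : ‖v‖ ≤ 1) {c : ENNReal}
    (h : ∀ x, volume {t ∈ Set.Icc (-1 : ℝ) 1 | x + t • v ∈ A} ≤ c) :
    μ A ≤ c * μ (Metric.ball 0 2) := by
  have hmeas : Measurable (fun p : E × ℝ => p.1 + p.2 • v) := by
    have : Continuous (fun p : E × ℝ => p.1 + p.2 • v) := by fun_prop
    exact this.measurable
  have hslice : ∀ x, ∫⁻ t in Set.Icc (-1 : ℝ) 1, A.indicator 1 (x + t • v)
      = volume {t ∈ Set.Icc (-1 : ℝ) 1 | x + t • v ∈ A} := by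
    intro x
    have hm : MeasurableSet {t : ℝ | x + t • v ∈ A} :=
      (hmeas.comp (measurable_const.prodMk measurable_id)) hA
    have : (fun t : ℝ => A.indicator (1 : E → ENNReal) (x + t • v))
        = {t : ℝ | x + t • v ∈ A}.indicator 1 := rfl
    rw [this, lintegral_indicator_one hm, Measure.restrict_apply hm, Set.inter_comm]
    rfl
  calc μ A ≤ ∫⁻ t in Set.Icc (-1 : ℝ) 1, μ A := by
        rw [lintegral_const, Measure.restrict_apply_univ, Real.volume_Icc]
        refine le_mul_of_one_le_right' ?_
        norm_num
    _ = ∫⁻ t in Set.Icc (-1 : ℝ) 1, ∫⁻ x, A.indicator 1 (x + t • v) ∂μ := by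
        refine lintegral_congr fun t => ?_
        rw [lintegral_add_right_eq_self (A.indicator (1 : E → ENNReal)), lintegral_indicator_one hA]
    _ = ∫⁻ x, (∫⁻ t in Set.Icc (-1 : ℝ) 1, A.indicator 1 (x + t • v)) ∂μ := by
        refine (lintegral_lintegral_swap (f := fun x t => A.indicator 1 (x + t • v)) ?_).symm
        exact ((measurable_one.indicator hA).comp hmeas).aemeasurable
    _ ≤ ∫⁻ x, (Metric.ball (0 : E) 2).indicator (fun _ => c) x ∂μ := by
        refine lintegral_mono fun x => ?_
        rw [hslice]
        by_cases hx : x ∈ Metric.ball (0 : E) 2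
        · simpa [hx] using h x
        · rw [Set.indicator_of_notMem hx, nonpos_iff_eq_zero]
          convert measure_empty (μ := (volume : Measure ℝ))
          rw [Set.eq_empty_iff_forall_notMem]
          rintro t ⟨ht, htA⟩
          refine hx ?_
          have h1 := hAB htA
          rw [mem_ball_zero_iff] at h1 ⊢
          have h2 : ‖t • v‖ ≤ 1 := by
            rw [norm_smul, Real.norm_eq_abs]
            exact mul_le_one₀ (abs_le.2 ht) (norm_nonneg _) hv
          calc ‖x‖ = ‖(x + t • v) - t • v‖ := by simp
            _ ≤ ‖x + t • v‖ + ‖t • v‖ := norm_sub_le _ _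
            _ < 2 := by linarith
    _ = c * μ (Metric.ball 0 2) := by
        rw [lintegral_indicator Metric.isOpen_ball.measurableSet, lintegral_const,
          Measure.restrict_apply_univ]

theorem volume_small_value_large_partial {d : ℕ} {W : Type*} [NormedAddCommGroup W]
    [NormedSpace ℝ W] {H : (Fin d → ℝ) → W} (hH : ContDiff ℝ 1 H) {K ε δ : ℝ} (hK : 1 ≤ K)
    (hε : 0 < ε) (hδ : 0 < δ) (hδ1 : δ ≤ 1)
    (hlip : ∀ x ∈ Metric.ball 0 1, ∀ y ∈ Metric.ball 0 1,
      ‖fderiv ℝ H x - fderiv ℝ H y‖ ≤ K * ‖x - y‖) {v : Fin d → ℝ} (hv : ‖v‖ = 1) :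
    volume {x ∈ Metric.ball (0 : Fin d → ℝ) 1 | ‖H x‖ < ε ∧ δ ≤ ‖fderiv ℝ H x v‖} ≤
      ENNReal.ofReal (20 * K * 4 ^ d * (ε / δ ^ 2)) := by
  have hK0 : 0 < K := by linarith
  have hH' : Continuous (fderiv ℝ H) := hH.continuous_fderiv one_ne_zero
  have hslice : ∀ x : Fin d → ℝ, volume {t ∈ Set.Icc (-1 : ℝ) 1 | x + t • v ∈
      {x ∈ Metric.ball (0 : Fin d → ℝ) 1 | ‖H x‖ < ε ∧ δ ≤ ‖fderiv ℝ H x v‖}} ≤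
      ENNReal.ofReal ((2 / (δ / (2 * K)) + 1) * (4 * ε / δ)) := by
    intro x
    refine volume_le_of_locally_small (fun t ht => ht.1) (by positivity) (by positivity) ?_
    rintro s ⟨-, hsB, hs1, hs2⟩ t ⟨-, htB, ht1, -⟩ hst
    set y := x + s • v
    set y' := x + t • v
    have hyy : y' - y = (t - s) • v := by simp [y, y', sub_smul]
    have hn : ‖y' - y‖ = |s - t| := by
      rw [hyy, norm_smul, hv, mul_one, Real.norm_eq_abs, abs_sub_comm]
    have hsub : segment ℝ y y' ⊆ Metric.ball 0 1 := (convex_ball 0 1).segment_subset hsB htB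
    have key : ‖H y' - H y - fderiv ℝ H y (y' - y)‖ ≤ (K * |s - t|) * ‖y' - y‖ := by
      refine Convex.norm_image_sub_le_of_norm_fderiv_le' (s := segment ℝ y y')
        (fun z _ => hH.differentiable one_ne_zero z) (fun z hz => ?_) (convex_segment _ _)
        (left_mem_segment _ _ _) (right_mem_segment _ _ _)
      refine (hlip z (hsub hz) y hsB).trans ?_
      rw [← hn]
      gcongr
      obtain ⟨a, ha, rfl⟩ := (segment_eq_image' ℝ y y' ▸ hz :)
      rw [add_sub_cancel_left, norm_smul, Real.norm_eq_abs, abs_of_nonneg ha.1]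
      exact mul_le_of_le_one_left (norm_nonneg _) ha.2
    have hlow : |s - t| * δ ≤ ‖fderiv ℝ H y (y' - y)‖ := by
      rw [hyy, map_smul, norm_smul, Real.norm_eq_abs, abs_sub_comm]
      gcongr
    have htri : ‖fderiv ℝ H y (y' - y)‖ ≤
        ‖H y' - H y - fderiv ℝ H y (y' - y)‖ + (‖H y'‖ + ‖H y‖) := by
      calc ‖fderiv ℝ H y (y' - y)‖
          = ‖(H y' - H y) - (H y' - H y - fderiv ℝ H y (y' - y))‖ := by congr 1; abel
        _ ≤ ‖H y' - H y‖ + ‖H y' - H y - fderiv ℝ H y (y' - y)‖ := norm_sub_le _ _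
        _ ≤ _ := by linarith [norm_sub_le (H y') (H y)]
    rw [hn] at key
    have hq : K * |s - t| * |s - t| ≤ δ / 2 * |s - t| := by
      gcongr
      calc K * |s - t| ≤ K * (δ / (2 * K)) := by gcongr
        _ = δ / 2 := by field_simp
    rw [le_div_iff₀ hδ]
    linarith
  have hmeas : MeasurableSet
      {x ∈ Metric.ball (0 : Fin d → ℝ) 1 | ‖H x‖ < ε ∧ δ ≤ ‖fderiv ℝ H x v‖} := by
    refine Metric.isOpen_ball.measurableSet.inter (MeasurableSet.inter ?_ ?_)
    · exact (isOpen_lt hH.continuous.norm continuous_const).measurableSet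
    · exact (isClosed_le continuous_const (hH'.clm_apply continuous_const).norm).measurableSet
  refine (measure_le_of_slices volume hmeas (fun x hx => hx.1) hv.le hslice).trans ?_
  rw [Real.volume_pi_ball _ two_pos, Fintype.card_fin, ← ENNReal.ofReal_mul (by positivity)]
  refine ENNReal.ofReal_le_ofReal ?_
  have h1 : 2 / (δ / (2 * K)) + 1 ≤ 5 * K / δ := by
    have : 2 / (δ / (2 * K)) = 4 * K / δ := by field_simp; norm_num
    rw [this, ← sub_nonneg]
    have : 5 * K / δ - (4 * K / δ + 1) = (K - δ) / δ := by field_simp; ring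
    rw [this]
    exact div_nonneg (by linarith) hδ.le
  calc (2 / (δ / (2 * K)) + 1) * (4 * ε / δ) * (2 * 2) ^ d
      ≤ (5 * K / δ) * (4 * ε / δ) * (2 * 2) ^ d := by gcongr
    _ = 20 * K * 4 ^ d * (ε / δ ^ 2) := by norm_num; field_simp; norm_num

theorem volume_small_value_large_fderiv {d : ℕ} {W : Type*} [NormedAddCommGroup W]
    [NormedSpace ℝ W] {H : (Fin d → ℝ) → W} (hH : ContDiff ℝ 1 H) {K ε δ : ℝ} (hK : 1 ≤ K)
    (hε : 0 < ε) (hδ : 0 < δ) (hδ1 : δ ≤ 1)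
    (hlip : ∀ x ∈ Metric.ball 0 1, ∀ y ∈ Metric.ball 0 1,
      ‖fderiv ℝ H x - fderiv ℝ H y‖ ≤ K * ‖x - y‖) :
    volume {x ∈ Metric.ball (0 : Fin d → ℝ) 1 | ‖H x‖ < ε ∧ δ ≤ ‖fderiv ℝ H x‖} ≤
      ENNReal.ofReal (d * (20 * K * 4 ^ d * (d + 1) ^ 2) * (ε / δ ^ 2)) := by
  set δ' := δ / (d + 1) with hδ'
  have hδ'0 : 0 < δ' := by positivity
  have hδ'1 : δ' ≤ 1 := (div_le_self hδ.le (by linarith [d.cast_nonneg (α := ℝ)])).trans hδ1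
  have hcover : {x ∈ Metric.ball (0 : Fin d → ℝ) 1 | ‖H x‖ < ε ∧ δ ≤ ‖fderiv ℝ H x‖} ⊆
      ⋃ i ∈ (Finset.univ : Finset (Fin d)), {x ∈ Metric.ball (0 : Fin d → ℝ) 1 |
        ‖H x‖ < ε ∧ δ' ≤ ‖fderiv ℝ H x (Pi.single i 1)‖} := by
    rintro x ⟨hxB, hx1, hx2⟩
    by_contra hcon
    simp only [Finset.mem_univ, Set.iUnion_true, Set.mem_iUnion, Set.mem_ofPred_eq, not_exists,
      not_and, not_le] at hcon
    have hb : ‖fderiv ℝ H x‖ ≤ d * δ' := by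
      refine ContinuousLinearMap.opNorm_le_bound _ (by positivity) fun w => ?_
      calc ‖fderiv ℝ H x w‖ = ‖∑ i, w i • fderiv ℝ H x (Pi.single i 1)‖ := by
            conv_lhs => rw [pi_eq_sum_univ' w, map_sum]
            exact congrArg _ (Finset.sum_congr rfl fun i _ => map_smul _ _ _)
        _ ≤ ∑ i : Fin d, δ' * ‖w‖ := by
            refine norm_sum_le_of_le _ fun i _ => ?_
            rw [norm_smul, mul_comm]
            exact mul_le_mul (hcon i hxB hx1).le (norm_le_pi_norm w i) (norm_nonneg _) hδ'0.le
        _ = d * δ' * ‖w‖ := by simp [mul_assoc]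
    have : δ = d * δ' + δ' := by rw [hδ']; field_simp
    linarith
  refine (measure_mono hcover).trans ((measure_biUnion_finset_le _ _).trans ?_)
  refine (Finset.sum_le_sum fun i _ => volume_small_value_large_partial hH hK hε hδ'0 hδ'1 hlip
    (v := Pi.single i 1) (by rw [Pi.norm_single, norm_one])).trans ?_
  rw [Finset.sum_const, Finset.card_univ, Fintype.card_fin, nsmul_eq_mul,
    ← ENNReal.ofReal_natCast, ← ENNReal.ofReal_mul (by positivity)]
  refine le_of_eq (congrArg _ ?_)
  rw [hδ']
  field_simp

theorem exists_volume_sublevel_le (d l : ℕ) {K : ℝ} (hK : 1 ≤ K) :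
    ∃ C : ℝ, 0 < C ∧ ∃ α : ℝ, 0 < α ∧ ∀ G : (Fin d → ℝ) → ℝ, ContDiff ℝ (⊤ : ℕ∞) G →
      (∀ x ∈ Metric.ball 0 1, ∀ m ≤ l + 1, ‖iteratedFDeriv ℝ m G x‖ ≤ K) →
      (∀ x ∈ Metric.ball 0 1, ∃ m ≤ l, K⁻¹ ≤ ‖iteratedFDeriv ℝ m G x‖) →
      ∀ ε : ℝ, 0 < ε → volume {x ∈ Metric.ball (0 : Fin d → ℝ) 1 | |G x| < ε} ≤
        ENNReal.ofReal (C * ε ^ α) := by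
  have hK0 : 0 < K := by linarith
  set C₁ : ℝ := d * (20 * K * 4 ^ d * (d + 1) ^ 2) with hC₁
  set θ : ℕ → ℝ := fun j => ((3 : ℝ) ^ j)⁻¹ with hθ
  have hθ0 : ∀ j, 0 < θ j := fun j => by positivity
  have hθanti : ∀ i j, i ≤ j → θ j ≤ θ i := fun i j hij => by
    simp only [hθ]
    gcongr
    norm_num
  refine ⟨l * C₁ + 2 ^ d * K, by positivity, θ l, hθ0 l, fun G hG hup hlow ε hε => ?_⟩
  rcases le_or_gt K⁻¹ (ε ^ θ l) with hbig | hsmall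
  · refine (measure_mono (fun x hx => hx.1 : _ ⊆ Metric.ball (0 : Fin d → ℝ) 1)).trans ?_
    rw [Real.volume_pi_ball _ one_pos, Fintype.card_fin]
    refine ENNReal.ofReal_le_ofReal ?_
    have h1 : 1 ≤ K * ε ^ θ l := by
      calc 1 = K * K⁻¹ := (mul_inv_cancel₀ hK0.ne').symm
        _ ≤ _ := by gcongr
    calc ((2 : ℝ) * 1) ^ d = 2 ^ d * 1 := by simp
      _ ≤ 2 ^ d * (K * ε ^ θ l) := by gcongr
      _ ≤ l * C₁ * ε ^ θ l + 2 ^ d * (K * ε ^ θ l) := le_add_of_nonneg_left (by positivity)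
      _ = _ := by ring
  have hε1 : ε < 1 := by
    by_contra! h
    have := Real.one_le_rpow h (hθ0 l).le
    have := inv_le_one_of_one_le₀ hK
    linarith
  have hcover : {x ∈ Metric.ball (0 : Fin d → ℝ) 1 | |G x| < ε} ⊆
      ⋃ j ∈ Finset.range l, {x ∈ Metric.ball (0 : Fin d → ℝ) 1 |
        ‖iteratedFDeriv ℝ j G x‖ < ε ^ θ j ∧
        ε ^ θ (j + 1) ≤ ‖fderiv ℝ (iteratedFDeriv ℝ j G) x‖} := by
    rintro x ⟨hxB, hx⟩
    by_contra hcon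
    simp only [Finset.mem_range, Set.mem_iUnion, Set.mem_ofPred_eq, not_exists,
      not_and, not_le, norm_fderiv_iteratedFDeriv] at hcon
    have hall : ∀ j ≤ l, ‖iteratedFDeriv ℝ j G x‖ < ε ^ θ j := by
      intro j
      induction j with
      | zero => intro _; simpa [hθ] using hx
      | succ j ih => exact fun hj => hcon j hj hxB (ih (by omega))
    obtain ⟨m, hm, hle⟩ := hlow x hxB
    have : ε ^ θ m ≤ ε ^ θ l := Real.rpow_le_rpow_of_exponent_ge hε hε1.le (hθanti m l hm)
    linarith [hall m hm]
  refine (measure_mono hcover).trans ((measure_biUnion_finset_le _ _).trans ?_)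
  calc _ ≤ ∑ j ∈ Finset.range l, ENNReal.ofReal (C₁ * ε ^ θ l) := by
        refine Finset.sum_le_sum fun j hj => ?_
        have hj : j < l := Finset.mem_range.1 hj
        have hdiff : ∀ m : ℕ, Differentiable ℝ (iteratedFDeriv ℝ m G) := fun m =>
          hG.differentiable_iteratedFDeriv (by exact_mod_cast WithTop.coe_lt_top m)
        refine (volume_small_value_large_fderiv
          (hG.iteratedFDeriv_right (m := 1) (by exact_mod_cast le_top)) hK
          (Real.rpow_pos_of_pos hε _) (Real.rpow_pos_of_pos hε _)
          (Real.rpow_le_one hε.le hε1.le (hθ0 _).le) ?_).trans ?_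
        · intro x hx y hy
          have h1 : ‖iteratedFDeriv ℝ (j + 1) G x - iteratedFDeriv ℝ (j + 1) G y‖
              ≤ K * ‖x - y‖ := by
            refine Convex.norm_image_sub_le_of_norm_fderiv_le (s := Metric.ball 0 1) (𝕜 := ℝ)
              (fun z _ => hdiff (j + 1) z) (fun z hz => ?_) (convex_ball _ _) hy hx
            rw [norm_fderiv_iteratedFDeriv]
            exact hup z hz _ (by omega)
          rw [iteratedFDeriv_succ_eq_comp_left] at h1
          simp only [Function.comp_apply] at h1
          rwa [← dist_eq_norm, LinearIsometryEquiv.dist_map, dist_eq_norm] at h1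
        · refine ENNReal.ofReal_le_ofReal (mul_le_mul_of_nonneg_left ?_ (by positivity))
          have : ε ^ θ j / (ε ^ θ (j + 1)) ^ 2 = ε ^ θ (j + 1) := by
            rw [← Real.rpow_mul_natCast hε.le, ← Real.rpow_sub hε]
            congr 1
            simp only [hθ, pow_succ]
            field_simp
            norm_num
          rw [this]
          exact Real.rpow_le_rpow_of_exponent_ge hε hε1.le (hθanti _ _ hj)
    _ = ENNReal.ofReal (l * (C₁ * ε ^ θ l)) := by
        rw [Finset.sum_const, Finset.card_range, nsmul_eq_mul, ← ENNReal.ofReal_natCast,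
          ← ENNReal.ofReal_mul (by positivity)]
    _ ≤ _ := by
        refine ENNReal.ofReal_le_ofReal ?_
        have : 0 ≤ 2 ^ d * K * ε ^ θ l := by positivity
        linarith

/-- The derivatives of orders `0, …, l` of `G` at `x`. -/
noncomputable def jet {E : Type*} [NormedAddCommGroup E] [NormedSpace ℝ E] (l : ℕ) (G : E → ℝ)
    (x : E) : (m : Fin (l + 1)) → ContinuousMultilinearMap ℝ (fun _ : Fin m => E) ℝ :=
  fun m => iteratedFDeriv ℝ m G x

theorem norm_iteratedFDeriv_le_jet {E : Type*} [NormedAddCommGroup E] [NormedSpace ℝ E] {l m : ℕ}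
    (hm : m ≤ l) (G : E → ℝ) (x : E) : ‖iteratedFDeriv ℝ m G x‖ ≤ ‖jet l G x‖ :=
  norm_le_pi_norm (jet l G x) ⟨m, Nat.lt_succ_of_le hm⟩

theorem exists_norm_iteratedFDeriv_eq_jet {E : Type*} [NormedAddCommGroup E] [NormedSpace ℝ E]
    (l : ℕ) (G : E → ℝ) (x : E) : ∃ m ≤ l, ‖iteratedFDeriv ℝ m G x‖ = ‖jet l G x‖ := by
  obtain ⟨m, hm⟩ := Finite.exists_max fun m => ‖jet l G x m‖
  refine ⟨m, Nat.le_of_lt_succ m.2, le_antisymm (norm_le_pi_norm (jet l G x) m) ?_⟩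
  exact (pi_norm_le_iff_of_nonneg (norm_nonneg _)).2 hm

theorem norm_jet_le {E : Type*} [NormedAddCommGroup E] [NormedSpace ℝ E] {l : ℕ} {G : E → ℝ}
    (hG : ContDiff ℝ (⊤ : ℕ∞) G) {K : ℝ} (hK : 1 ≤ K) {s : Set E} (hs : Convex ℝ s)
    (hGK : ∀ x ∈ s, ‖iteratedFDeriv ℝ (l + 1) G x‖ ≤ K * ‖jet l G x‖) {x y : E} (hx : x ∈ s)
    (hy : y ∈ s) : ‖jet l G y‖ ≤ ‖jet l G x‖ * Real.exp (K * ‖y - x‖) := by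
  set γ : ℝ → E := fun t => x + t • (y - x) with hγ
  have hγs : ∀ t ∈ Set.Icc (0 : ℝ) 1, γ t ∈ s := fun t ht => hs.add_smul_sub_mem hx hy ht
  have hder : ∀ t, HasDerivAt (fun t => jet l G (γ t))
      (fun m : Fin (l + 1) => fderiv ℝ (iteratedFDeriv ℝ m G) (γ t) (y - x)) t := by
    intro t
    rw [hasDerivAt_pi]
    intro m
    have hγ' : HasDerivAt γ (y - x) t := by
      simpa [hγ] using ((hasDerivAt_id t).smul_const (y - x)).const_add x
    have hd : Differentiable ℝ (iteratedFDeriv ℝ m G) :=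
      hG.differentiable_iteratedFDeriv (by exact_mod_cast WithTop.coe_lt_top (m : ℕ))
    exact (hd (γ t)).hasFDerivAt.comp_hasDerivAt t hγ'
  have hbound : ∀ t ∈ Set.Icc (0 : ℝ) 1,
      ‖fun m : Fin (l + 1) => fderiv ℝ (iteratedFDeriv ℝ m G) (γ t) (y - x)‖
        ≤ K * ‖y - x‖ * ‖jet l G (γ t)‖ + 0 := by
    intro t ht
    rw [add_zero, pi_norm_le_iff_of_nonneg (by positivity)]
    intro m
    refine (ContinuousLinearMap.le_opNorm _ _).trans ?_
    rw [norm_fderiv_iteratedFDeriv]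
    have : ‖iteratedFDeriv ℝ (m + 1) G (γ t)‖ ≤ K * ‖jet l G (γ t)‖ := by
      rcases (Nat.le_of_lt_succ m.2).lt_or_eq with h | h
      · exact (norm_iteratedFDeriv_le_jet h G _).trans
          (le_mul_of_one_le_left (norm_nonneg _) hK)
      · rw [h]
        exact hGK _ (hγs t ht)
    calc _ ≤ K * ‖jet l G (γ t)‖ * ‖y - x‖ := by gcongr
      _ = _ := by ring
  have := norm_le_gronwallBound_of_norm_deriv_right_le (f := fun t => jet l G (γ t)) (δ := ‖jet l G x‖)
    (fun t _ => (hder t).continuousAt.continuousWithinAt) (fun t _ => (hder t).hasDerivWithinAt)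
    (by simp [hγ]) (fun t ht => hbound t ⟨ht.1, ht.2.le⟩) 1 (by simp)
  simpa [gronwallBound_ε0, hγ] using this

theorem exists_volume_sublevel_sup_le (d l : ℕ) {K : ℝ} (hK : 1 ≤ K) :
    ∃ C : ℝ, 0 < C ∧ ∃ α : ℝ, 0 < α ∧ ∀ G : (Fin d → ℝ) → ℝ, ContDiff ℝ (⊤ : ℕ∞) G →
      (∀ x ∈ Metric.ball 0 1, ‖iteratedFDeriv ℝ (l + 1) G x‖ ≤ K * ‖jet l G x‖) →
      ∀ ε : ℝ, 0 < ε → volume {x ∈ Metric.ball (0 : Fin d → ℝ) 1 |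
          |G x| < ε * sSup ((fun y => |G y|) '' Metric.ball 0 1)} ≤
        ENNReal.ofReal (C * ε ^ α) := by
  set R := Real.exp K with hR
  have hR1 : 1 ≤ R := Real.one_le_exp (by linarith)
  have hR0 : 0 < R := by linarith
  have hKR : 1 ≤ K * R := one_le_mul_of_one_le_of_one_le hK hR1
  obtain ⟨C, hC, α, hα, h⟩ := exists_volume_sublevel_le d l hKR
  refine ⟨C * R ^ α, by positivity, α, hα, fun G hG hGK ε hε => ?_⟩
  set M := ‖jet l G 0‖ with hM
  have h0 : (0 : Fin d → ℝ) ∈ Metric.ball (0 : Fin d → ℝ) 1 := by simp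
  have hexp : ∀ x ∈ Metric.ball (0 : Fin d → ℝ) 1, Real.exp (K * ‖x‖) ≤ R := fun x hx => by
    rw [mem_ball_zero_iff] at hx
    exact Real.exp_le_exp.2 (mul_le_of_le_one_right (by linarith) hx.le)
  have hle : ∀ x ∈ Metric.ball (0 : Fin d → ℝ) 1, ‖jet l G x‖ ≤ M * R := fun x hx => by
    have := norm_jet_le hG hK (convex_ball _ _) hGK h0 hx
    rw [sub_zero] at this
    exact this.trans (mul_le_mul_of_nonneg_left (hexp x hx) (norm_nonneg _))
  have hge : ∀ x ∈ Metric.ball (0 : Fin d → ℝ) 1, M ≤ ‖jet l G x‖ * R := fun x hx => by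
    have := norm_jet_le hG hK (convex_ball _ _) hGK hx h0
    rw [zero_sub, norm_neg] at this
    exact this.trans (mul_le_mul_of_nonneg_left (hexp x hx) (norm_nonneg _))
  have hGle : ∀ x ∈ Metric.ball (0 : Fin d → ℝ) 1, |G x| ≤ M * R := fun x hx => by
    have := norm_iteratedFDeriv_le_jet (Nat.zero_le l) G x
    rw [norm_iteratedFDeriv_zero, Real.norm_eq_abs] at this
    exact this.trans (hle x hx)
  have hsup : sSup ((fun y => |G y|) '' Metric.ball 0 1) ≤ M * R :=
    csSup_le (Set.Nonempty.image _ ⟨0, h0⟩) (by rintro _ ⟨x, hx, rfl⟩; exact hGle x hx)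
  rcases (norm_nonneg (jet l G 0)).eq_or_lt with hM0 | hM0
  · rw [← hM] at hM0
    refine le_of_eq_of_le ?_ zero_le
    convert measure_empty (μ := (volume : Measure (Fin d → ℝ)))
    rw [Set.eq_empty_iff_forall_notMem]
    rintro x ⟨-, hx⟩
    rw [← hM0, zero_mul] at hsup
    exact absurd (hx.trans_le (mul_nonpos_of_nonneg_of_nonpos hε.le hsup)) (abs_nonneg _).not_gt
  · rw [← hM] at hM0
    have hscale : ∀ m x, ‖iteratedFDeriv ℝ m (M⁻¹ • G) x‖ = M⁻¹ * ‖iteratedFDeriv ℝ m G x‖ := by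
      intro m x
      rw [iteratedFDeriv_const_smul_apply, norm_smul, norm_inv, Real.norm_eq_abs,
        abs_of_pos hM0]
      exact (hG.of_le (by exact_mod_cast le_top)).contDiffAt
    have := h (M⁻¹ • G) (contDiff_const.smul hG) ?_ ?_ (ε * R) (by positivity)
    · rw [mul_assoc, ← Real.mul_rpow hR0.le hε.le, mul_comm R]
      refine le_trans (measure_mono ?_) this
      rintro x ⟨hx, hxlt⟩
      refine ⟨hx, ?_⟩
      rw [Pi.smul_apply, smul_eq_mul, abs_mul, abs_inv, abs_of_pos hM0, inv_mul_lt_iff₀ hM0]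
      calc |G x| < ε * _ := hxlt
        _ ≤ ε * (M * R) := by gcongr
        _ = _ := by ring
    · intro x hx m hm
      rw [hscale, inv_mul_le_iff₀ hM0]
      rcases hm.lt_or_eq with hm | rfl
      · calc _ ≤ ‖jet l G x‖ := norm_iteratedFDeriv_le_jet (Nat.le_of_lt_succ hm) G x
          _ ≤ M * R := hle x hx
          _ ≤ K * (M * R) := le_mul_of_one_le_left (by positivity) hK
          _ = _ := by ring
      · calc _ ≤ K * ‖jet l G x‖ := hGK x hx
          _ ≤ K * (M * R) := by gcongr; exact hle x hx
          _ = _ := by ring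
    · intro x hx
      obtain ⟨m, hm, heq⟩ := exists_norm_iteratedFDeriv_eq_jet l G x
      refine ⟨m, hm, ?_⟩
      rw [hscale, heq, inv_mul_eq_div, le_div_iff₀ hM0, inv_mul_le_iff₀ (by positivity)]
      calc M ≤ ‖jet l G x‖ * R := hge x hx
        _ ≤ K * (‖jet l G x‖ * R) := le_mul_of_one_le_left (by positivity) hK
        _ = _ := by ring

theorem norm_iteratedFDeriv_comp_affine {E F : Type*} [NormedAddCommGroup E] [NormedSpace ℝ E]
    [NormedAddCommGroup F] [NormedSpace ℝ F] {g : E → F} (hg : ContDiff ℝ (⊤ : ℕ∞) g) (z : E)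
    {ρ : ℝ} (hρ : 0 ≤ ρ) (m : ℕ) (t : E) :
    ‖iteratedFDeriv ℝ m (fun t => g (z + ρ • t)) t‖ =
      ρ ^ m * ‖iteratedFDeriv ℝ m g (z + ρ • t)‖ := by
  have h1 := (ρ • ContinuousLinearMap.id ℝ E).iteratedFDeriv_comp_right
    (f := fun y => g (z + y)) (n := (m : WithTop ℕ∞))
    ((hg.comp (contDiff_const.add contDiff_id)).of_le (by exact_mod_cast le_top)) t le_rfl
  have h2 : (fun t => g (z + ρ • t)) = (fun y => g (z + y)) ∘ (ρ • ContinuousLinearMap.id ℝ E) := rfl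
  have h3 : iteratedFDeriv ℝ m (fun t => g (z + ρ • t)) t =
      ρ ^ m • iteratedFDeriv ℝ m g (z + ρ • t) := by
    rw [h2, h1, iteratedFDeriv_comp_add_left]
    ext u
    simp [ContinuousMultilinearMap.map_smul_univ]
  rw [h3, norm_smul, norm_pow, Real.norm_of_nonneg hρ]

theorem iteratedFDeriv_const_add_clm_comp {E F W : Type*} [NormedAddCommGroup E] [NormedSpace ℝ E]
    [NormedAddCommGroup F] [NormedSpace ℝ F] [NormedAddCommGroup W] [NormedSpace ℝ W]
    {f : E → W} (hf : ContDiff ℝ (⊤ : ℕ∞) f) (a : F) (φ : W →L[ℝ] F) {m : ℕ} (hm : m ≠ 0) (x : E) :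
    iteratedFDeriv ℝ m (fun x => a + φ (f x)) x =
      φ.compContinuousMultilinearMap (iteratedFDeriv ℝ m f x) := by
  have hf' : ContDiff ℝ m f := hf.of_le (by exact_mod_cast le_top)
  have h1 : (fun x => a + φ (f x)) = (fun _ => a) + φ ∘ f := rfl
  rw [h1, iteratedFDeriv_add_apply contDiff_const.contDiffAt (φ.contDiff.comp hf').contDiffAt,
    iteratedFDeriv_const_of_ne hm, Pi.zero_apply, zero_add,
    φ.iteratedFDeriv_comp_left hf'.contDiffAt le_rfl]

theorem IsGoodOn.congr_mono {d : ℕ} {C α : ℝ} {g g' : (Fin d → ℝ) → ℝ} {V V' : Set (Fin d → ℝ)}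
    (h : IsGoodOn C α g V) (hV : V' ⊆ V) (hg : Set.EqOn g' g V') : IsGoodOn C α g' V' := by
  intro z ρ hρ hB ε hε
  have h1 : (fun y => |g' y|) '' Metric.ball z ρ = (fun y => |g y|) '' Metric.ball z ρ :=
    Set.image_congr fun y hy => by rw [hg (hB hy)]
  rw [h1]
  refine le_trans (measure_mono ?_) (h z ρ hρ (hB.trans hV) ε hε)
  rintro x ⟨hx, hlt⟩
  exact ⟨hx, by rwa [← hg (hB hx)]⟩

theorem isGoodOn_of_const {d : ℕ} {C α : ℝ} (hC : 1 ≤ C) (hα : 0 < α) {g : (Fin d → ℝ) → ℝ}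
    {V : Set (Fin d → ℝ)} (hg : ∀ x ∈ V, ∀ y ∈ V, g x = g y) : IsGoodOn C α g V := by
  intro z ρ hρ hB ε hε
  have hz : z ∈ Metric.ball z ρ := Metric.mem_ball_self hρ
  have h1 : (fun y => |g y|) '' Metric.ball z ρ = {|g z|} := by
    rw [← Set.Nonempty.image_const ⟨z, hz⟩ |g z|]
    exact Set.image_congr fun y hy => by rw [hg y (hB hy) z (hB hz)]
  rw [h1, csSup_singleton]
  rcases le_or_gt ε 1 with h | h
  · refine le_of_eq_of_le ?_ zero_le
    convert measure_empty (μ := (volume : Measure (Fin d → ℝ)))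
    rw [Set.eq_empty_iff_forall_notMem]
    rintro x ⟨hx, hlt⟩
    rw [hg x (hB hx) z (hB hz)] at hlt
    exact hlt.not_ge (mul_le_of_le_one_left (abs_nonneg _) h)
  · refine (measure_mono fun x hx => hx.1).trans (le_mul_of_one_le_left' ?_)
    rw [ENNReal.one_le_ofReal]
    exact one_le_mul_of_one_le_of_one_le hC (Real.one_le_rpow h.le hα.le)

theorem volume_sublevel_ball_le_of_rescaled {d : ℕ} {g : (Fin d → ℝ) → ℝ} {z : Fin d → ℝ}
    {ρ ε c : ℝ} (hρ : 0 < ρ) (h : volume {t ∈ Metric.ball (0 : Fin d → ℝ) 1 | |g (z + ρ • t)| <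
      ε * sSup ((fun t => |g (z + ρ • t)|) '' Metric.ball 0 1)} ≤ ENNReal.ofReal c) :
    volume {x ∈ Metric.ball z ρ | |g x| < ε * sSup ((fun y => |g y|) '' Metric.ball z ρ)} ≤
      ENNReal.ofReal c * volume (Metric.ball z ρ) := by
  have hmem : ∀ t, z + ρ • t ∈ Metric.ball z ρ ↔ t ∈ Metric.ball (0 : Fin d → ℝ) 1 := by
    intro t
    rw [mem_ball_iff_norm, add_sub_cancel_left, norm_smul, Real.norm_of_nonneg hρ.le,
      mem_ball_zero_iff]
    exact mul_lt_iff_lt_one_right hρ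
  have hball : Metric.ball z ρ = (fun t => z + ρ • t) '' Metric.ball 0 1 := by
    ext x
    constructor
    · intro hx
      have hx' : z + ρ • ρ⁻¹ • (x - z) = x := by rw [smul_inv_smul₀ hρ.ne']; abel
      exact ⟨ρ⁻¹ • (x - z), by rwa [← hmem, hx'], hx'⟩
    · rintro ⟨t, ht, rfl⟩
      exact (hmem t).2 ht
  have himg : (fun t => |g (z + ρ • t)|) '' Metric.ball 0 1 =
      (fun y => |g y|) '' Metric.ball z ρ := by
    rw [hball, Set.image_image]
  rw [himg] at h
  set S := {x ∈ Metric.ball z ρ | |g x| < ε * sSup ((fun y => |g y|) '' Metric.ball z ρ)}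
  have hpre : {t ∈ Metric.ball (0 : Fin d → ℝ) 1 | |g (z + ρ • t)| <
      ε * sSup ((fun y => |g y|) '' Metric.ball z ρ)} =
      (ρ • ·) ⁻¹' ((fun y => z + y) ⁻¹' S) := by
    ext t
    exact and_congr_left' (hmem t).symm
  rw [hpre, Measure.addHaar_preimage_smul _ hρ.ne', measure_preimage_add, Module.finrank_fin_fun,
    abs_of_pos (by positivity)] at h
  calc volume S = ENNReal.ofReal (ρ ^ d) * (ENNReal.ofReal (ρ ^ d)⁻¹ * volume S) := by
        rw [← mul_assoc, ← ENNReal.ofReal_mul (by positivity), mul_inv_cancel₀ (by positivity),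
          ENNReal.ofReal_one, one_mul]
    _ ≤ ENNReal.ofReal (ρ ^ d) * ENNReal.ofReal c := by gcongr
    _ ≤ _ := by
        rw [mul_comm, Real.volume_pi_ball _ hρ, Fintype.card_fin]
        gcongr
        linarith

theorem exists_norm_le_of_span_eq_top {E W : Type*} [NormedAddCommGroup E] [NormedSpace ℝ E]
    [NormedAddCommGroup W] [NormedSpace ℝ W] [FiniteDimensional ℝ W] (l : ℕ)
    (T : (m : Fin l) → ContinuousMultilinearMap ℝ (fun _ : Fin (m + 1) => E) W)
    (hT : Submodule.span ℝ {y | ∃ m u, y = T m u} = ⊤) :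
    ∃ κ : ℝ, 0 < κ ∧ ∀ φ : W →L[ℝ] ℝ, φ ≠ 0 →
      ∃ m, ‖φ‖ ≤ κ * ‖φ.compContinuousMultilinearMap (T m)‖ := by
  let Φ : (W →L[ℝ] ℝ) →ₗ[ℝ] ((m : Fin l) → ContinuousMultilinearMap ℝ (fun _ : Fin (m + 1) => E) ℝ) :=
    { toFun := fun φ m => φ.compContinuousMultilinearMap (T m)
      map_add' := fun φ ψ => by ext; simp
      map_smul' := fun c φ => by ext; simp }
  have hker : Φ.ker = ⊥ := by
    rw [LinearMap.ker_eq_bot']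
    intro φ hφ
    have hle : Submodule.span ℝ {y | ∃ m u, y = T m u} ≤ LinearMap.ker φ.toLinearMap := by
      rw [Submodule.span_le]
      rintro _ ⟨m, u, rfl⟩
      have := congrArg (fun A => A u) (congrFun hφ m)
      simpa [Φ] using this
    rw [hT] at hle
    ext w
    simpa using hle (Submodule.mem_top (x := w))
  obtain ⟨κ, hκ, hanti⟩ := Φ.exists_antilipschitzWith hker
  have hκ' : (0 : ℝ) < κ := hκ
  refine ⟨κ, hκ', fun φ hφ => ?_⟩
  by_contra! hcon
  have h1 : ‖φ‖ ≤ κ * ‖Φ φ‖ := by simpa using hanti.le_mul_dist φ 0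
  have h2 : ‖Φ φ‖ < ‖φ‖ / κ := by
    rw [pi_norm_lt_iff (div_pos (norm_pos_iff.2 hφ) hκ')]
    intro m
    rw [lt_div_iff₀ hκ', mul_comm]
    exact hcon m
  rw [lt_div_iff₀ hκ', mul_comm] at h2
  linarith

theorem exists_isGoodOn_of_span_eq_top {d l : ℕ} {W : Type*} [NormedAddCommGroup W]
    [NormedSpace ℝ W] [FiniteDimensional ℝ W] {F : (Fin d → ℝ) → W}
    (hF : ContDiff ℝ (⊤ : ℕ∞) F) (x₀ : Fin d → ℝ)
    (hspan : Submodule.span ℝ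
      {y | ∃ m : Fin l, ∃ u, y = iteratedFDeriv ℝ (m + 1) F x₀ u} = ⊤) :
    ∃ V ∈ nhds x₀, ∃ C : ℝ, 0 < C ∧ ∃ α : ℝ, 0 < α ∧
      ∀ (a : ℝ) (φ : W →L[ℝ] ℝ), IsGoodOn C α (fun x => a + φ (F x)) V := by
  rcases Nat.eq_zero_or_pos d with rfl | hd
  · exact ⟨Set.univ, Filter.univ_mem, 1, one_pos, 1, one_pos, fun a φ =>
      isGoodOn_of_const le_rfl one_pos fun x _ y _ => by rw [Subsingleton.elim x y]⟩
  obtain ⟨κ, hκ, hlow⟩ := exists_norm_le_of_span_eq_top l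
    (fun m => iteratedFDeriv ℝ (m + 1) F x₀) hspan
  set A := ‖iteratedFDeriv ℝ (l + 1) F x₀‖ + 1 with hA
  have hA0 : 0 < A := by positivity
  have hcont : ∀ m : ℕ, Continuous (iteratedFDeriv ℝ m F) := fun m =>
    hF.continuous_iteratedFDeriv (by exact_mod_cast le_top)
  have hev : ∀ᶠ x in nhds x₀, (∀ m : Fin l,
      ‖iteratedFDeriv ℝ (m + 1) F x₀ - iteratedFDeriv ℝ (m + 1) F x‖ < 1 / (2 * κ)) ∧
      ‖iteratedFDeriv ℝ (l + 1) F x‖ < A := by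
    refine Filter.Eventually.and (Filter.eventually_all.2 fun m => ?_) ?_
    · have hpos : 0 < 1 / (2 * κ) := by positivity
      filter_upwards [(hcont (m + 1)).continuousAt.eventually (Metric.ball_mem_nhds _ hpos)]
        with x hx
      rw [← dist_eq_norm, dist_comm]
      exact hx
    · exact (hcont (l + 1)).norm.continuousAt.eventually_lt continuousAt_const (by simp [hA])
  obtain ⟨r, hr, hball⟩ := Metric.eventually_nhds_iff_ball.1 hev
  obtain ⟨C, hC, α, hα, hmain⟩ := exists_volume_sublevel_sup_le d l
    (K := 1 + 2 * κ * A) (by linarith [mul_pos (mul_pos two_pos hκ) hA0])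
  refine ⟨Metric.ball x₀ (min r 1), Metric.ball_mem_nhds _ (by positivity), C + 1, by positivity,
    α, hα, fun a φ => ?_⟩
  by_cases hφ : φ = 0
  · exact isGoodOn_of_const (by linarith) hα fun x _ y _ => by simp [hφ]
  intro z ρ hρ hB ε hε
  have hρ1 : ρ ≤ 1 := by
    have h1 := measure_mono (μ := volume) (hB.trans (Metric.ball_subset_ball (min_le_right r 1)))
    rw [Real.volume_pi_ball _ hρ, Real.volume_pi_ball _ one_pos, Fintype.card_fin,
      ENNReal.ofReal_le_ofReal_iff (by positivity),
      pow_le_pow_iff_left₀ (by positivity) (by norm_num) hd.ne'] at h1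
    linarith
  set g : (Fin d → ℝ) → ℝ := fun x => a + φ (F x) with hg
  have hgs : ContDiff ℝ (⊤ : ℕ∞) g := contDiff_const.add (φ.contDiff.comp hF)
  refine volume_sublevel_ball_le_of_rescaled hρ ?_
  refine (hmain (fun t => g (z + ρ • t)) ?_ ?_ ε hε).trans ?_
  · exact hgs.comp (contDiff_const.add (contDiff_id.const_smul ρ))
  · intro t ht
    have hx : z + ρ • t ∈ Metric.ball x₀ r := by
      refine Metric.ball_subset_ball (min_le_left r 1) (hB ?_)
      rw [mem_ball_iff_norm, add_sub_cancel_left, norm_smul, Real.norm_of_nonneg hρ.le]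
      exact mul_lt_of_lt_one_right hρ (mem_ball_zero_iff.1 ht)
    obtain ⟨hx1, hx2⟩ := hball _ hx
    set x := z + ρ • t with hxdef
    have hφ0 : 0 < ‖φ‖ := norm_pos_iff.2 hφ
    obtain ⟨m, hm⟩ := hlow φ hφ
    have hm' : ‖φ‖ ≤ 2 * κ * ‖iteratedFDeriv ℝ (m + 1) g x‖ := by
      rw [hg, iteratedFDeriv_const_add_clm_comp hF a φ (Nat.succ_ne_zero _)]
      have h1 : ‖φ.compContinuousMultilinearMap (iteratedFDeriv ℝ (m + 1) F x₀)‖ ≤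
          ‖φ‖ * (1 / (2 * κ)) +
            ‖φ.compContinuousMultilinearMap (iteratedFDeriv ℝ (m + 1) F x)‖ := by
        have h2 : φ.compContinuousMultilinearMap (iteratedFDeriv ℝ (m + 1) F x₀) =
            φ.compContinuousMultilinearMap
              (iteratedFDeriv ℝ (m + 1) F x₀ - iteratedFDeriv ℝ (m + 1) F x) +
            φ.compContinuousMultilinearMap (iteratedFDeriv ℝ (m + 1) F x) := by
          ext u; simp
        rw [h2]
        refine (norm_add_le _ _).trans (add_le_add_left ?_ _)
        refine (φ.norm_compContinuousMultilinearMap_le _).trans ?_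
        gcongr
        exact (hx1 m).le
      have h3 : κ * (‖φ‖ * (1 / (2 * κ))) = ‖φ‖ / 2 := by field_simp
      have h4 := mul_le_mul_of_nonneg_left h1 hκ.le
      rw [mul_add, h3] at h4
      linarith
    have hup : ‖iteratedFDeriv ℝ (l + 1) g x‖ ≤ ‖φ‖ * A := by
      rw [hg, iteratedFDeriv_const_add_clm_comp hF a φ (Nat.succ_ne_zero _)]
      refine (φ.norm_compContinuousMultilinearMap_le _).trans ?_
      gcongr
    have hjet := norm_iteratedFDeriv_le_jet (Nat.succ_le_of_lt m.2) (fun t => g (z + ρ • t)) t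
    rw [Nat.succ_eq_add_one, norm_iteratedFDeriv_comp_affine hgs z hρ.le] at hjet
    rw [norm_iteratedFDeriv_comp_affine hgs z hρ.le]
    have hpow : ρ ^ (l + 1) ≤ ρ ^ ((m : ℕ) + 1) :=
      pow_le_pow_of_le_one hρ.le hρ1 (by omega)
    calc ρ ^ (l + 1) * ‖iteratedFDeriv ℝ (l + 1) g x‖
        ≤ ρ ^ ((m : ℕ) + 1) * (2 * κ * ‖iteratedFDeriv ℝ (m + 1) g x‖ * A) := by
          gcongr
          exact hup.trans (by gcongr)
      _ = 2 * κ * A * (ρ ^ ((m : ℕ) + 1) * ‖iteratedFDeriv ℝ (m + 1) g x‖) := by ring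
      _ ≤ 2 * κ * A * ‖jet l (fun t => g (z + ρ • t)) t‖ := by gcongr
      _ ≤ _ := by gcongr; linarith
  · refine ENNReal.ofReal_le_ofReal ?_
    gcongr
    linarith

theorem exists_contDiff_eventuallyEq {E F : Type*} [NormedAddCommGroup E] [NormedSpace ℝ E]
    [HasContDiffBump E] [FiniteDimensional ℝ E] [NormedAddCommGroup F] [NormedSpace ℝ F]
    {U : Set E} (hU : IsOpen U) {f : E → F} (hf : ContDiffOn ℝ (⊤ : ℕ∞) f U) {x₀ : E}
    (hx₀ : x₀ ∈ U) : ∃ f' : E → F, ContDiff ℝ (⊤ : ℕ∞) f' ∧ f' =ᶠ[nhds x₀] f := by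
  obtain ⟨R, hR, hRU⟩ := Metric.nhds_basis_closedBall.mem_iff.1 (hU.mem_nhds hx₀)
  let χ : ContDiffBump x₀ := ⟨R / 2, R, by positivity, by linarith⟩
  refine ⟨fun x => χ x • f x, contDiff_iff_contDiffAt.2 fun x => ?_, ?_⟩
  · by_cases hx : x ∈ U
    · exact χ.contDiff.contDiffAt.smul (hf.contDiffAt (hU.mem_nhds hx))
    · have hx' : x ∉ tsupport χ := fun h => hx (hRU (χ.tsupport_eq ▸ h))
      refine (contDiffAt_const (c := (0 : F))).congr_of_eventuallyEq ?_
      filter_upwards [notMem_tsupport_iff_eventuallyEq.1 hx'] with y hy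
      simp [hy]
  · filter_upwards [χ.eventuallyEq_one] with y hy
    simp [hy]

/-- **Corollary 3.2.** If `L` is an affine subspace of `ℝ^n` and `f` is a smooth map from an
open subset `U` of `ℝ^d` to `L` which is nondegenerate in `L` at `x₀ ∈ U`, then `f` is good
at `x₀`. -/
theorem good_of_nondeg (d n : ℕ) (L : AffineSubspace ℝ (Fin n → ℝ))
    (U : Set (Fin d → ℝ)) (hU : IsOpen U)
    (f : (Fin d → ℝ) → Fin n → ℝ) (hf : ContDiffOn ℝ (⊤ : ℕ∞) f U)
    (hfL : ∀ x ∈ U, f x ∈ L)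
    (x₀ : Fin d → ℝ) (hx₀ : x₀ ∈ U) (hnd : NondegAt U L f x₀) :
    GoodAt U f x₀ := by
  obtain ⟨l, hl⟩ := hnd
  obtain ⟨f', hf', heq⟩ := exists_contDiff_eventuallyEq hU hf hx₀
  obtain ⟨P₀, hP₀⟩ := L.direction.subtype.exists_leftInverse_of_injective
    (Submodule.ker_subtype _)
  set P : (Fin n → ℝ) →L[ℝ] L.direction := LinearMap.toContinuousLinearMap P₀
  have hP : ∀ (y : Fin n → ℝ) (hy : y ∈ L.direction), P y = ⟨y, hy⟩ := fun y hy =>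
    LinearMap.congr_fun hP₀ ⟨y, hy⟩
  set F : (Fin d → ℝ) → L.direction := fun x => -P (f x₀) + P (f' x) with hFdef
  have hF : ContDiff ℝ (⊤ : ℕ∞) F := contDiff_const.add (P.contDiff.comp hf')
  have hspan : Submodule.span ℝ
      {y | ∃ m : Fin l, ∃ u, y = iteratedFDeriv ℝ (m + 1) F x₀ u} = ⊤ := by
    have himage : P '' {y : Fin n → ℝ | ∃ m : ℕ, 1 ≤ m ∧ m ≤ l ∧
        ∃ u : Fin m → (Fin d → ℝ), y = iteratedFDerivWithin ℝ m f U x₀ u} ⊆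
        {y | ∃ m : Fin l, ∃ u, y = iteratedFDeriv ℝ (m + 1) F x₀ u} := by
      rintro _ ⟨_, ⟨m, hm1, hml, u, rfl⟩, rfl⟩
      obtain ⟨k, rfl⟩ := Nat.exists_eq_add_of_le' hm1
      refine ⟨⟨k, hml⟩, u, ?_⟩
      rw [hFdef, iteratedFDeriv_const_add_clm_comp hf' _ P (Nat.succ_ne_zero _),
        iteratedFDerivWithin_of_isOpen _ hU hx₀, ← (heq.iteratedFDeriv ℝ (k + 1)).eq_of_nhds]
      rfl
    rw [eq_top_iff]
    refine le_trans ?_ (Submodule.span_mono himage)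
    rw [← ContinuousLinearMap.coe_coe, Submodule.span_image, hl]
    exact fun w _ => ⟨w, w.2, hP w w.2⟩
  obtain ⟨V, hV, C, hC, α, hα, hgood⟩ := exists_isGoodOn_of_span_eq_top hF x₀ hspan
  refine ⟨V ∩ (U ∩ {x | f' x = f x}), Filter.inter_mem hV (Filter.inter_mem (hU.mem_nhds hx₀) heq),
    fun x hx => hx.2.1, C, hC, α, hα, fun c₀ c => ?_⟩
  let ψ : (Fin n → ℝ) →L[ℝ] ℝ := ∑ i, c i • ContinuousLinearMap.proj i
  have hψ : ∀ y, ψ y = ∑ i, c i * y i := fun y => by simp [ψ]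
  refine (hgood (c₀ + ψ (f x₀)) (ψ.comp L.direction.subtypeL)).congr_mono Set.inter_subset_left ?_
  rintro x ⟨-, hxU, hx : f' x = f x⟩
  have hdir : f x - f x₀ ∈ L.direction := L.vsub_mem_direction (hfL x hxU) (hfL x₀ hx₀)
  have hFx : F x = ⟨f x - f x₀, hdir⟩ := by
    rw [← hP, map_sub, hFdef]
    simp only [hx]
    abel
  simp only [hFx, ← hψ, ContinuousLinearMap.comp_apply, Submodule.subtypeL_apply, map_sub]
  ring
end

section
/- Let f be a real analytic map from a connected open subset U of ℝ^d to ℝ^n. Then there exists an affine subspace L of ℝ^n such that f takes values in L and f is nondegenerate in L at every point of U; consequently, f is good at every point of U. -/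
open MeasureTheory

section Averaging

variable {E : Type*} [NormedAddCommGroup E] [NormedSpace ℝ E] [MeasurableSpace E] [BorelSpace E]
  [FiniteDimensional ℝ E] (μ : Measure E) [μ.IsAddHaarMeasure]

/-- A measurable subset of a ball whose sections along lines in direction `v` have length at
most `κ` has small measure. -/
theorem measure_mul_le_of_line_sections {G : Set E} (hG : MeasurableSet G) {u v : E} {s κ : ℝ}
    (hGu : G ⊆ Metric.ball u s) (hv : ‖v‖ ≤ 1)
    (h : ∀ (x : E) (t₁ t₂ : ℝ), x + t₁ • v ∈ G → x + t₂ • v ∈ G → |t₁ - t₂| ≤ κ) :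
    μ G * ENNReal.ofReal s ≤ ENNReal.ofReal κ * μ (Metric.ball u (2 * s)) := by
  set w : E → ℝ → ENNReal := fun x t => G.indicator 1 (x + t • v) with hw
  have hmeas : Measurable (Function.uncurry w) := by
    have : Measurable fun p : E × ℝ => p.1 + p.2 • v := by
      apply Continuous.measurable
      fun_prop
    exact (measurable_one.indicator hG).comp this
  calc μ G * ENNReal.ofReal s = ∫⁻ _ in Set.Ioo 0 s, μ G := by simp
    _ = ∫⁻ t in Set.Ioo 0 s, ∫⁻ x, w x t ∂μ := by
      congr 1
      ext t
      rw [hw, lintegral_add_right_eq_self (fun x => G.indicator (1 : E → ENNReal) x) (t • v),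
        lintegral_indicator_one hG]
    _ = ∫⁻ x, (∫⁻ t in Set.Ioo 0 s, w x t) ∂μ :=
      (lintegral_lintegral_swap hmeas.aemeasurable).symm
    _ ≤ ∫⁻ x, (Metric.ball u (2 * s)).indicator (fun _ => ENNReal.ofReal κ) x ∂μ := by
      refine lintegral_mono fun x => ?_
      by_cases hx : x ∈ Metric.ball u (2 * s)
      · rw [Set.indicator_of_mem hx]
        have hT : MeasurableSet {t : ℝ | x + t • v ∈ G} := by
          refine hG.preimage (Continuous.measurable ?_)
          fun_prop
        calc ∫⁻ t in Set.Ioo 0 s, w x t ≤ ∫⁻ t, w x t := setLIntegral_le_lintegral _ _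
          _ = ∫⁻ t, {t : ℝ | x + t • v ∈ G}.indicator 1 t := rfl
          _ = volume {t : ℝ | x + t • v ∈ G} := lintegral_indicator_one hT
          _ ≤ Metric.ediam {t : ℝ | x + t • v ∈ G} := Real.volume_le_diam _
          _ ≤ ENNReal.ofReal κ := by
            refine Metric.ediam_le fun t₁ h₁ t₂ h₂ => ?_
            rw [edist_dist, Real.dist_eq]
            exact ENNReal.ofReal_le_ofReal (h x t₁ t₂ h₁ h₂)
      · rw [Set.indicator_of_notMem hx]
        refine le_of_eq ?_
        refine (setLIntegral_eq_zero_iff' (f := w x) measurableSet_Ioo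
          (hmeas.comp measurable_prodMk_left).aemeasurable).2 ?_
        refine Filter.Eventually.of_forall fun t ht => ?_
        refine Set.indicator_of_notMem (fun hmem => hx ?_) _
        have h1 := hGu hmem
        rw [mem_ball_iff_norm] at h1 ⊢
        have h2 : ‖t • v‖ ≤ s := by
          rw [norm_smul, Real.norm_eq_abs, abs_of_pos ht.1]
          nlinarith [ht.1, ht.2]
        calc ‖x - u‖ = ‖(x + t • v - u) - t • v‖ := by congr 1; abel
          _ ≤ ‖x + t • v - u‖ + ‖t • v‖ := norm_sub_le _ _
          _ < 2 * s := by linarith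
    _ = ENNReal.ofReal κ * μ (Metric.ball u (2 * s)) := by
      rw [lintegral_indicator_const Metric.isOpen_ball.measurableSet]

/-- A local bound for the measure of `F` in small balls gives a global one. -/
theorem measure_mul_le_of_measure_inter_ball_le {F : Set E} (hF : MeasurableSet F) {z : E}
    {ρ s : ℝ} (hFz : F ⊆ Metric.ball z ρ) {β : ENNReal}
    (h : ∀ u, μ (F ∩ Metric.ball u s) ≤ β) :
    μ F * μ (Metric.ball 0 s) ≤ β * μ (Metric.ball z (ρ + s)) := by
  set w : E → E → ENNReal := fun x u => {p : E × E | p.1 ∈ F ∧ dist p.1 p.2 < s}.indicator 1 (x, u)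
    with hw
  have hS : MeasurableSet {p : E × E | p.1 ∈ F ∧ dist p.1 p.2 < s} :=
    (hF.preimage measurable_fst).inter (isOpen_lt (continuous_fst.dist continuous_snd) continuous_const).measurableSet
  have hmeas : Measurable (Function.uncurry w) := measurable_one.indicator hS
  have h1 : ∀ x, ∫⁻ u, w x u ∂μ = F.indicator (fun _ => μ (Metric.ball 0 s)) x := by
    intro x
    by_cases hx : x ∈ F
    · rw [Set.indicator_of_mem hx, ← Measure.addHaar_ball_center μ x,
        ← lintegral_indicator_one Metric.isOpen_ball.measurableSet]
      refine lintegral_congr fun u => ?_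
      have hiff : (x, u) ∈ {p : E × E | p.1 ∈ F ∧ dist p.1 p.2 < s} ↔ u ∈ Metric.ball x s := by
        rw [Metric.mem_ball']
        exact and_iff_right hx
      by_cases hu : u ∈ Metric.ball x s
      · rw [Set.indicator_of_mem hu, hw]
        exact Set.indicator_of_mem (hiff.2 hu) _
      · rw [Set.indicator_of_notMem hu, hw]
        exact Set.indicator_of_notMem (fun h' => hu (hiff.1 h')) _
    · simp [hw, hx]
  have h2 : ∀ u, ∫⁻ x, w x u ∂μ = μ (F ∩ Metric.ball u s) := by
    intro u
    rw [← lintegral_indicator_one (hF.inter Metric.isOpen_ball.measurableSet)]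
    rfl
  calc μ F * μ (Metric.ball 0 s) = ∫⁻ x, ∫⁻ u, w x u ∂μ ∂μ := by
        simp_rw [h1]
        rw [lintegral_indicator_const hF, mul_comm]
    _ = ∫⁻ u, ∫⁻ x, w x u ∂μ ∂μ := lintegral_lintegral_swap hmeas.aemeasurable
    _ ≤ ∫⁻ u, (Metric.ball z (ρ + s)).indicator (fun _ => β) u ∂μ := by
      refine lintegral_mono fun u => ?_
      rw [h2]
      by_cases hu : u ∈ Metric.ball z (ρ + s)
      · rw [Set.indicator_of_mem hu]
        exact h u
      · rw [Set.indicator_of_notMem hu, nonpos_iff_eq_zero]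
        convert measure_empty (μ := μ)
        rw [Set.eq_empty_iff_forall_notMem]
        rintro x ⟨hxF, hxu⟩
        refine hu ?_
        have := hFz hxF
        rw [Metric.mem_ball] at *
        linarith [dist_triangle_left u z x]
    _ = β * μ (Metric.ball z (ρ + s)) := by
      rw [lintegral_indicator_const Metric.isOpen_ball.measurableSet]

/-- If `H` is small and its derivative is large on `F`, then `F` has small measure. -/
theorem measure_le_of_norm_lt_of_le_norm_fderiv {W : Type*} [NormedAddCommGroup W]
    [NormedSpace ℝ W] {H : E → W} {H' : E → E →L[ℝ] W} {z : E} {ρ δ m K : ℝ}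
    (hH : ∀ x ∈ Metric.ball z ρ, HasFDerivAt H (H' x) x)
    (hH' : ∀ x ∈ Metric.ball z ρ, ∀ y ∈ Metric.ball z ρ, ‖H' y - H' x‖ ≤ K * ‖y - x‖)
    (hδ : 0 < δ) (hm : 0 < m) (hK : 0 < K) (hmK : m ≤ 4 * K * ρ) {F : Set E}
    (hF : MeasurableSet F) (hFz : F ⊆ Metric.ball z ρ) (hFδ : ∀ x ∈ F, ‖H x‖ < δ)
    (hFm : ∀ x ∈ F, m ≤ ‖H' x‖) :
    μ F ≤ ENNReal.ofReal (8 ^ Module.finrank ℝ E * (32 * (K * δ / m ^ 2))) *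
      μ (Metric.ball z ρ) := by
  set s : ℝ := m / (4 * K) with hs
  have hs0 : 0 < s := by positivity
  have hsK : K * s = m / 4 := by rw [hs]; field_simp
  have hsρ : s ≤ ρ := by
    rw [hs, div_le_iff₀ (by positivity)]; linarith
  set D := Module.finrank ℝ E
  have hball : ∀ (x : E) (c r : ℝ), 0 < c → μ (Metric.ball x (c * r)) =
      ENNReal.ofReal (c ^ D) * μ (Metric.ball 0 r) := fun x c r hc =>
    Measure.addHaar_ball_mul_of_pos μ x hc r
  have hlocal : ∀ u ∈ F, μ (F ∩ Metric.ball u s) * ENNReal.ofReal s ≤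
      ENNReal.ofReal (8 * δ / m) * μ (Metric.ball u (2 * s)) := by
    intro u hu
    obtain ⟨v, hv1, hv⟩ := (H' u).exists_lt_apply_of_lt_opNorm
      (show m / 2 < ‖H' u‖ by linarith [hFm u hu])
    refine measure_mul_le_of_line_sections μ (hF.inter Metric.isOpen_ball.measurableSet)
      Set.inter_subset_right hv1.le ?_
    rintro x t₁ t₂ ⟨h₁F, h₁⟩ ⟨h₂F, h₂⟩
    have hconv : Convex ℝ (Metric.ball z ρ ∩ Metric.ball u s) :=
      (convex_ball z ρ).inter (convex_ball u s)
    have key := hconv.norm_image_sub_le_of_norm_hasFDerivWithin_le' (f := H) (f' := H')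
      (φ := H' u) (C := K * s) (fun y hy => (hH y hy.1).hasFDerivWithinAt)
      (fun y hy => (hH' u (hFz hu) y hy.1).trans (by
        have := mem_ball_iff_norm.1 hy.2
        gcongr)) ⟨hFz h₂F, h₂⟩ ⟨hFz h₁F, h₁⟩
    have hdiff : x + t₁ • v - (x + t₂ • v) = (t₁ - t₂) • v := by
      rw [sub_smul]; abel
    rw [hdiff, map_smul, hsK] at key
    have e1 : ‖(t₁ - t₂) • (H' u) v‖ ≤ ‖H (x + t₁ • v)‖ + ‖H (x + t₂ • v)‖
        + m / 4 * ‖(t₁ - t₂) • v‖ := by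
      have e2 := norm_sub_norm_le ((t₁ - t₂) • (H' u) v) (H (x + t₁ • v) - H (x + t₂ • v))
      rw [norm_sub_rev ((t₁ - t₂) • (H' u) v)] at e2
      have e3 := norm_sub_le (H (x + t₁ • v)) (H (x + t₂ • v))
      linarith
    rw [norm_smul, norm_smul, Real.norm_eq_abs] at e1
    have e4 := hFδ _ h₁F
    have e5 := hFδ _ h₂F
    have e6 : |t₁ - t₂| * ‖v‖ ≤ |t₁ - t₂| * 1 := by gcongr
    have e7 : |t₁ - t₂| * (m / 2) ≤ |t₁ - t₂| * ‖(H' u) v‖ := by gcongr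
    rw [le_div_iff₀ hm]
    nlinarith
  have hs2 : ENNReal.ofReal s ≠ 0 := by simpa using hs0
  have hloc2 : ∀ u, μ (F ∩ Metric.ball u (s / 2)) ≤
      ENNReal.ofReal (8 * δ / m / s * 4 ^ D) * μ (Metric.ball 0 (s / 2)) := by
    intro u
    rcases (F ∩ Metric.ball u (s / 2)).eq_empty_or_nonempty with he | ⟨u', hu'F, hu'⟩
    · simp [he]
    · have hsub : F ∩ Metric.ball u (s / 2) ⊆ F ∩ Metric.ball u' s := by
        refine Set.inter_subset_inter_right _ (Metric.ball_subset_ball' ?_)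
        rw [Metric.mem_ball, dist_comm] at hu'
        linarith
      refine (measure_mono hsub).trans ?_
      have h1 := hlocal u' hu'F
      rw [← ENNReal.le_div_iff_mul_le (Or.inl hs2) (Or.inl ENNReal.ofReal_ne_top)] at h1
      refine h1.trans (le_of_eq ?_)
      rw [show 2 * s = 4 * (s / 2) by ring, hball _ _ _ (by norm_num),
        ENNReal.ofReal_mul (by positivity), ENNReal.ofReal_div_of_pos hs0,
        ENNReal.div_eq_inv_mul, ENNReal.div_eq_inv_mul]
      ring
  have hglob := measure_mul_le_of_measure_inter_ball_le μ hF hFz hloc2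
  have hb0 : μ (Metric.ball 0 (s / 2)) ≠ 0 := (Metric.measure_ball_pos μ _ (by positivity)).ne'
  have hbt : μ (Metric.ball 0 (s / 2)) ≠ ⊤ := measure_ball_lt_top.ne
  rw [mul_right_comm, ENNReal.mul_le_mul_iff_left hb0 hbt] at hglob
  calc μ F ≤ ENNReal.ofReal (8 * δ / m / s * 4 ^ D) * μ (Metric.ball z (ρ + s / 2)) := hglob
    _ ≤ ENNReal.ofReal (8 * δ / m / s * 4 ^ D) * μ (Metric.ball z (2 * ρ)) := by
      gcongr
      linarith
    _ = ENNReal.ofReal (8 ^ D * (32 * (K * δ / m ^ 2))) * μ (Metric.ball z ρ) := by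
      rw [hball _ _ _ two_pos, Measure.addHaar_ball_center μ z, ← mul_assoc,
        ← ENNReal.ofReal_mul (by positivity)]
      congr 2
      rw [show (8 : ℝ) = 4 * 2 by norm_num, mul_pow, hs]
      field_simp
      ring

end Averaging

section Sublevel

variable {E : Type*} [NormedAddCommGroup E] [NormedSpace ℝ E]

theorem norm_fderiv_iteratedFDeriv_sub {W : Type*} [NormedAddCommGroup W] [NormedSpace ℝ W]
    (g : E → W) (j : ℕ) (x y : E) :
    ‖fderiv ℝ (iteratedFDeriv ℝ j g) y - fderiv ℝ (iteratedFDeriv ℝ j g) x‖ =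
      ‖iteratedFDeriv ℝ (j + 1) g y - iteratedFDeriv ℝ (j + 1) g x‖ := by
  rw [fderiv_iteratedFDeriv, ← dist_eq_norm (iteratedFDeriv ℝ (j + 1) g y)]
  exact (dist_eq_norm _ _).symm.trans (LinearIsometryEquiv.dist_map
    (continuousMultilinearCurryLeftEquiv ℝ (fun _ : Fin (j + 1) => E) W) _ _)

theorem norm_iteratedFDeriv_sub_le {g : E → ℝ} {s : Set E} (hs : Convex ℝ s)
    (hg : AnalyticOnNhd ℝ g s) {j : ℕ} {M : ℝ} (hM : ∀ x ∈ s, ‖iteratedFDeriv ℝ (j + 1) g x‖ ≤ M)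
    {x y : E} (hx : x ∈ s) (hy : y ∈ s) :
    ‖iteratedFDeriv ℝ j g y - iteratedFDeriv ℝ j g x‖ ≤ M * ‖y - x‖ :=
  hs.norm_image_sub_le_of_norm_hasFDerivWithin_le
    (fun w hw => (hg.iteratedFDeriv j w hw).differentiableAt.hasFDerivAt.hasFDerivWithinAt)
    (fun w hw => by rw [norm_fderiv_iteratedFDeriv]; exact hM w hw) hx hy

/-- The scale invariant jet norms of `g` at two points of a ball are comparable as soon as the
derivative of top order is controlled by the lower order ones. -/
theorem pow_mul_norm_iteratedFDeriv_le {g : E → ℝ} {z : E} {ρ m K : ℝ} {l : ℕ} (hρ : 0 < ρ)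
    (hρ1 : ρ ≤ 1) (hK : 0 ≤ K) (hm : 0 < m) (hg : AnalyticOnNhd ℝ g (Metric.ball z ρ))
    (hlow : ∀ x ∈ Metric.ball z ρ, ∃ j ≤ l, m ≤ ‖iteratedFDeriv ℝ j g x‖)
    (htop : ∀ x ∈ Metric.ball z ρ, ‖iteratedFDeriv ℝ (l + 1) g x‖ ≤ K * m)
    {x : E} (hx : x ∈ Metric.ball z ρ) (i : ℕ) (hi : i ≤ l + 1) :
    ∀ y ∈ Metric.ball z ρ, ρ ^ (l + 1 - i) * ‖iteratedFDeriv ℝ (l + 1 - i) g y‖ ≤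
      3 ^ i * (K + 1) * ∑ j ∈ Finset.range (l + 1), ρ ^ j * ‖iteratedFDeriv ℝ j g x‖ := by
  set N := ∑ j ∈ Finset.range (l + 1), ρ ^ j * ‖iteratedFDeriv ℝ j g x‖ with hN
  have hterm : ∀ j ≤ l, ρ ^ j * ‖iteratedFDeriv ℝ j g x‖ ≤ N := fun j hj =>
    Finset.single_le_sum (f := fun j => ρ ^ j * ‖iteratedFDeriv ℝ j g x‖)
      (fun _ _ => by positivity) (Finset.mem_range.2 (by omega))
  have hN0 : 0 ≤ N := Finset.sum_nonneg fun _ _ => by positivity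
  induction i with
  | zero =>
    intro y hy
    obtain ⟨j, hj, hmj⟩ := hlow x hx
    have h1 : ρ ^ (l + 1) * m ≤ N := by
      refine le_trans ?_ (hterm j hj)
      gcongr ?_ * ?_
      exact pow_le_pow_of_le_one hρ.le hρ1 (by omega)
    have h2 := mul_le_mul_of_nonneg_left (htop y hy) (pow_nonneg hρ.le (l + 1))
    have h3 := mul_le_mul_of_nonneg_left h1 hK
    simp only [Nat.sub_zero, pow_zero, one_mul]
    linarith
  | succ i ih =>
    intro y hy
    obtain ⟨k, hk⟩ : ∃ k, l + 1 - i = k + 1 := ⟨l - i, by omega⟩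
    have hk' : l + 1 - (i + 1) = k := by omega
    have ih' := ih (by omega)
    rw [hk] at ih'
    rw [hk']
    set M := 3 ^ i * (K + 1) * N with hMdef
    have hM : ∀ w ∈ Metric.ball z ρ, ‖iteratedFDeriv ℝ (k + 1) g w‖ ≤ M / ρ ^ (k + 1) := by
      intro w hw
      rw [le_div_iff₀ (by positivity), mul_comm]
      exact ih' w hw
    have h1 := norm_iteratedFDeriv_sub_le (convex_ball z ρ) hg hM hx hy
    have hM0 : 0 ≤ M := by positivity
    have hdist : ‖y - x‖ ≤ 2 * ρ := by
      rw [← dist_eq_norm]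
      have := dist_triangle_right y x z
      rw [Metric.mem_ball] at hx hy
      linarith
    have h2 : ρ ^ k * ‖iteratedFDeriv ℝ k g y - iteratedFDeriv ℝ k g x‖ ≤ 2 * M := by
      calc ρ ^ k * ‖iteratedFDeriv ℝ k g y - iteratedFDeriv ℝ k g x‖
          ≤ ρ ^ k * (M / ρ ^ (k + 1) * (2 * ρ)) := by
            gcongr
            exact h1.trans (by gcongr)
        _ = 2 * M := by
          field_simp
          ring
    have h3 : ρ ^ k * ‖iteratedFDeriv ℝ k g y‖ ≤ ρ ^ k * ‖iteratedFDeriv ℝ k g x‖ +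
        ρ ^ k * ‖iteratedFDeriv ℝ k g y - iteratedFDeriv ℝ k g x‖ := by
      rw [← mul_add]
      gcongr
      have := norm_sub_norm_le (iteratedFDeriv ℝ k g y) (iteratedFDeriv ℝ k g x)
      linarith
    have h4 := hterm k (by omega)
    have h5 : N ≤ M := by
      rw [hMdef]
      refine le_mul_of_one_le_left hN0 ?_
      have : (1 : ℝ) ≤ 3 ^ i := one_le_pow₀ (by norm_num)
      nlinarith
    rw [pow_succ']
    calc ρ ^ k * ‖iteratedFDeriv ℝ k g y‖ ≤ 3 * M := by linarith
      _ = _ := by rw [hMdef]; ring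

variable [MeasurableSpace E] [BorelSpace E] [FiniteDimensional ℝ E] (μ : Measure E)
  [μ.IsAddHaarMeasure]

/-- The points where a derivative of `g` is small while the next one is large. -/
theorem measure_norm_iteratedFDeriv_lt_le {g : E → ℝ} {z : E} {ρ N K₀ δ : ℝ} {j : ℕ} (hρ : 0 < ρ)
    (hN : 0 < N) (hK₀ : 1 ≤ K₀) (hδ : 0 < δ) (hδ1 : δ ≤ 1)
    (hg : AnalyticOnNhd ℝ g (Metric.ball z ρ))
    (hup : ∀ x ∈ Metric.ball z ρ, ρ ^ (j + 2) * ‖iteratedFDeriv ℝ (j + 2) g x‖ ≤ K₀ * N) :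
    μ {x ∈ Metric.ball z ρ | ρ ^ j * ‖iteratedFDeriv ℝ j g x‖ < δ ^ 3 * N ∧
      δ * N ≤ ρ ^ (j + 1) * ‖iteratedFDeriv ℝ (j + 1) g x‖} ≤
    ENNReal.ofReal (8 ^ Module.finrank ℝ E * 32 * K₀ * δ) * μ (Metric.ball z ρ) := by
  have hopen : ∀ (i : ℕ) (c : ℝ),
      MeasurableSet {x ∈ Metric.ball z ρ | ρ ^ i * ‖iteratedFDeriv ℝ i g x‖ < c} := by
    intro i c
    have hc : ContinuousOn (fun x => ρ ^ i * ‖iteratedFDeriv ℝ i g x‖) (Metric.ball z ρ) :=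
      continuousOn_const.mul (hg.iteratedFDeriv i).continuousOn.norm
    exact (hc.isOpen_inter_preimage Metric.isOpen_ball isOpen_Iio).measurableSet
  have hmeas : MeasurableSet {x ∈ Metric.ball z ρ | ρ ^ j * ‖iteratedFDeriv ℝ j g x‖ < δ ^ 3 * N ∧
      δ * N ≤ ρ ^ (j + 1) * ‖iteratedFDeriv ℝ (j + 1) g x‖} := by
    convert (hopen j (δ ^ 3 * N)).diff (hopen (j + 1) (δ * N)) using 1
    ext x
    constructor
    · rintro ⟨h1, h2, h3⟩
      exact ⟨⟨h1, h2⟩, fun h => h3.not_gt h.2⟩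
    · rintro ⟨⟨h1, h2⟩, h3⟩
      exact ⟨h1, h2, not_lt.1 fun h => h3 ⟨h1, h⟩⟩
  have hD2 : ∀ x ∈ Metric.ball z ρ, ‖iteratedFDeriv ℝ (j + 1 + 1) g x‖ ≤ K₀ * N / ρ ^ (j + 2) := by
    intro x hx
    rw [le_div_iff₀ (by positivity), mul_comm]
    exact hup x hx
  refine (measure_le_of_norm_lt_of_le_norm_fderiv μ (H := iteratedFDeriv ℝ j g)
    (H' := fderiv ℝ (iteratedFDeriv ℝ j g)) (z := z) (ρ := ρ) (δ := δ ^ 3 * N / ρ ^ j)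
    (m := δ * N / ρ ^ (j + 1)) (K := K₀ * N / ρ ^ (j + 2))
    (fun x hx => (hg.iteratedFDeriv j x hx).differentiableAt.hasFDerivAt) ?_ (by positivity)
    (by positivity) (by positivity) ?_ hmeas (fun x hx => hx.1) ?_ ?_).trans (le_of_eq ?_)
  · intro x hx y hy
    rw [norm_fderiv_iteratedFDeriv_sub]
    exact norm_iteratedFDeriv_sub_le (convex_ball z ρ) hg hD2 hx hy
  · calc δ * N / ρ ^ (j + 1) ≤ (4 * K₀) * N / ρ ^ (j + 1) := by gcongr; linarith
      _ = 4 * (K₀ * N / ρ ^ (j + 2)) * ρ := by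
        field_simp
        ring
  · rintro x ⟨-, hx, -⟩
    rw [lt_div_iff₀ (by positivity), mul_comm]
    exact hx
  · rintro x ⟨-, -, hx⟩
    rw [norm_fderiv_iteratedFDeriv, div_le_iff₀ (by positivity), mul_comm _ (ρ ^ (j + 1))]
    exact hx
  · congr 2
    field_simp
    ring

/-- Sublevel estimate for functions with a nonvanishing jet of order `l`, uniform in all data. -/
theorem exists_measure_sublevel_le (l : ℕ) {K : ℝ} (hK : 0 ≤ K) :
    ∃ C : ℝ, 0 < C ∧ ∃ α : ℝ, 0 < α ∧ ∀ (g : E → ℝ) (z : E) (ρ m : ℝ), 0 < ρ → ρ ≤ 1 → 0 < m →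
      AnalyticOnNhd ℝ g (Metric.ball z ρ) →
      (∀ x ∈ Metric.ball z ρ, ∃ j ≤ l, m ≤ ‖iteratedFDeriv ℝ j g x‖) →
      (∀ x ∈ Metric.ball z ρ, ‖iteratedFDeriv ℝ (l + 1) g x‖ ≤ K * m) → ∀ ε : ℝ, 0 < ε →
      μ {x ∈ Metric.ball z ρ | |g x| < ε * sSup ((fun y => |g y|) '' Metric.ball z ρ)} ≤
        ENNReal.ofReal (C * ε ^ α) * μ (Metric.ball z ρ) := by
  set D := Module.finrank ℝ E with hD
  set K₀ : ℝ := 3 ^ (l + 1) * (K + 1) with hK₀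
  have h3l : (1 : ℝ) ≤ 3 ^ (l + 1) := one_le_pow₀ (by norm_num)
  have hK₀1 : 1 ≤ K₀ := by rw [hK₀]; nlinarith
  set α : ℝ := ((3 ^ l : ℕ) : ℝ)⁻¹ with hα
  set A : ℝ := (l + 1) ^ 2 * K₀ + l * (8 ^ D * 32 * K₀) with hA
  have hA0 : 0 < A := by positivity
  refine ⟨A * K₀ ^ α, by positivity, α, by positivity, ?_⟩
  intro g z ρ m hρ hρ1 hm hg hlow htop ε hε
  set B := Metric.ball z ρ with hB
  have hzB : z ∈ B := Metric.mem_ball_self hρ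
  set δ : ℝ := (K₀ * ε) ^ α with hδ
  have hδ0 : 0 < δ := by positivity
  have hδpow : δ ^ (3 ^ l) = K₀ * ε :=
    Real.rpow_inv_natCast_pow (by positivity) (by positivity)
  have hconst : A * K₀ ^ α * ε ^ α = A * δ := by
    rw [hδ, Real.mul_rpow (by positivity) hε.le, mul_assoc]
  rw [hconst]
  by_cases hbig : 1 ≤ (l + 1) ^ 2 * K₀ * δ
  · calc _ ≤ μ B := measure_mono fun x hx => hx.1
      _ = ENNReal.ofReal 1 * μ B := by simp
      _ ≤ ENNReal.ofReal (A * δ) * μ B := by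
        gcongr
        refine hbig.trans ?_
        rw [hA]
        gcongr
        exact le_add_of_nonneg_right (by positivity)
  rw [not_le] at hbig
  set N : E → ℝ := fun x => ∑ j ∈ Finset.range (l + 1), ρ ^ j * ‖iteratedFDeriv ℝ j g x‖ with hN
  have hcomp : ∀ x ∈ B, ∀ j ≤ l + 1, ∀ y ∈ B, ρ ^ j * ‖iteratedFDeriv ℝ j g y‖ ≤ K₀ * N x := by
    intro x hx j hj y hy
    have hNx : 0 ≤ N x := Finset.sum_nonneg fun _ _ => by positivity
    have h := pow_mul_norm_iteratedFDeriv_le hρ hρ1 hK hm hg hlow htop hx (l + 1 - j) (by omega) y hy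
    rw [show l + 1 - (l + 1 - j) = j by omega] at h
    refine h.trans ?_
    rw [hK₀]
    gcongr
    · norm_num
    · omega
  have hNz : 0 < N z := by
    obtain ⟨j, hj, hmj⟩ := hlow z hzB
    have h1 : ρ ^ j * ‖iteratedFDeriv ℝ j g z‖ ≤ N z :=
      Finset.single_le_sum (f := fun j => ρ ^ j * ‖iteratedFDeriv ℝ j g z‖)
        (fun _ _ => by positivity) (Finset.mem_range.2 (by omega))
    have h2 : 0 < ρ ^ j * ‖iteratedFDeriv ℝ j g z‖ := mul_pos (by positivity) (hm.trans_le hmj)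
    linarith
  have hNle : ∀ x ∈ B, N z ≤ (l + 1) * K₀ * N x := by
    intro x hx
    calc N z ≤ ∑ j ∈ Finset.range (l + 1), K₀ * N x := Finset.sum_le_sum fun j hj =>
          hcomp x hx j (by have := Finset.mem_range.1 hj; omega) z hzB
      _ = (l + 1) * K₀ * N x := by simp; ring
  have hl1 : (1 : ℝ) ≤ (l + 1) ^ 2 := one_le_pow₀ (by linarith [(Nat.cast_nonneg l : (0 : ℝ) ≤ l)])
  have hδ1 : δ ≤ 1 := by
    by_contra! h
    have : (1 : ℝ) ≤ (l + 1) ^ 2 * K₀ := one_le_mul_of_one_le_of_one_le hl1 hK₀1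
    nlinarith
  set e : ℕ → ℝ := fun j => δ ^ (3 ^ (l - j)) with he
  have he0 : ∀ j, 0 < e j := fun j => by positivity
  have heδ : ∀ j, e j ≤ δ := fun j => pow_le_of_le_one hδ0.le hδ1 (by positivity)
  have hecube : ∀ j < l, e j = e (j + 1) ^ 3 := by
    intro j hj
    simp only [he]
    rw [← pow_mul, ← pow_succ, show l - (j + 1) + 1 = l - j by omega]
  set F : ℕ → Set E := fun j => {x ∈ B | ρ ^ j * ‖iteratedFDeriv ℝ j g x‖ < e (j + 1) ^ 3 * N z ∧
      e (j + 1) * N z ≤ ρ ^ (j + 1) * ‖iteratedFDeriv ℝ (j + 1) g x‖} with hF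
  have hFle : ∀ j ∈ Finset.range l, μ (F j) ≤ ENNReal.ofReal (8 ^ D * 32 * K₀ * δ) * μ B := by
    intro j hj
    have hj' := Finset.mem_range.1 hj
    refine (measure_norm_iteratedFDeriv_lt_le μ hρ hNz hK₀1 (he0 (j + 1))
      ((heδ _).trans hδ1) hg (hcomp z hzB (j + 2) (by omega))).trans ?_
    gcongr
    exact heδ _
  have hcover : {x ∈ B | |g x| < ε * sSup ((fun y => |g y|) '' B)} ⊆
      ⋃ j ∈ Finset.range l, F j := by
    rintro x ⟨hxB, hx⟩
    by_contra hnot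
    simp only [Set.mem_iUnion, not_exists] at hnot
    have hsup : sSup ((fun y => |g y|) '' B) ≤ K₀ * N z := by
      refine csSup_le (Set.Nonempty.image _ ⟨z, hzB⟩) ?_
      rintro _ ⟨y, hy, rfl⟩
      have := hcomp z hzB 0 (by omega) y hy
      rwa [pow_zero, one_mul, norm_iteratedFDeriv_zero, Real.norm_eq_abs] at this
    have hsmall : ∀ j ≤ l, ρ ^ j * ‖iteratedFDeriv ℝ j g x‖ < e j * N z := by
      intro j
      induction j with
      | zero =>
        intro _
        simp only [he, pow_zero, one_mul, norm_iteratedFDeriv_zero, Real.norm_eq_abs, Nat.sub_zero]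
        rw [hδpow]
        calc |g x| < ε * sSup ((fun y => |g y|) '' B) := hx
          _ ≤ ε * (K₀ * N z) := by gcongr
          _ = K₀ * ε * N z := by ring
      | succ j ih =>
        intro hj
        by_contra! hge
        refine hnot j (Finset.mem_range.2 (by omega)) ⟨hxB, ?_, hge⟩
        rw [← hecube j (by omega)]
        exact ih (by omega)
    have hsum : N x ≤ (l + 1) * δ * N z := by
      calc N x ≤ ∑ j ∈ Finset.range (l + 1), δ * N z := Finset.sum_le_sum fun j hj => by
            refine (hsmall j (by have := Finset.mem_range.1 hj; omega)).le.trans ?_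
            gcongr
            exact heδ j
        _ = (l + 1) * δ * N z := by simp; ring
    have h1 : N z ≤ (l + 1) ^ 2 * K₀ * δ * N z := by
      calc N z ≤ (l + 1) * K₀ * N x := hNle x hxB
        _ ≤ (l + 1) * K₀ * ((l + 1) * δ * N z) := by gcongr
        _ = (l + 1) ^ 2 * K₀ * δ * N z := by ring
    nlinarith
  calc _ ≤ μ (⋃ j ∈ Finset.range l, F j) := measure_mono hcover
    _ ≤ ∑ j ∈ Finset.range l, μ (F j) := measure_biUnion_finset_le _ _
    _ ≤ ∑ j ∈ Finset.range l, ENNReal.ofReal (8 ^ D * 32 * K₀ * δ) * μ B :=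
      Finset.sum_le_sum hFle
    _ = ENNReal.ofReal (l * (8 ^ D * 32 * K₀) * δ) * μ B := by
      rw [Finset.sum_const, Finset.card_range, nsmul_eq_mul, ← mul_assoc,
        ← ENNReal.ofReal_natCast, ← ENNReal.ofReal_mul (by positivity)]
      congr 2
      ring
    _ ≤ ENNReal.ofReal (A * δ) * μ B := by
      gcongr
      rw [hA]
      exact le_add_of_nonneg_left (by positivity)

end Sublevel

section Analytic

variable {E : Type*} [NormedAddCommGroup E] [NormedSpace ℝ E]

/-- An analytic function on a preconnected set all of whose derivatives of positive order vanish
at some point is constant. -/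
theorem AnalyticOnNhd.eq_of_iteratedFDeriv_eq_zero {g : E → ℝ} {U : Set E}
    (hg : AnalyticOnNhd ℝ g U) (hU : IsPreconnected U) {x : E} (hx : x ∈ U)
    (h : ∀ j, 1 ≤ j → iteratedFDeriv ℝ j g x = 0) {y : E} (hy : y ∈ U) : g y = g x := by
  obtain ⟨p, r, hp⟩ := hg x hx
  have hev : g =ᶠ[nhds x] fun _ => g x := by
    filter_upwards [Metric.eball_mem_nhds x hp.r_pos] with w hw
    have hw' : w - x ∈ Metric.eball (0 : E) r := by
      rwa [Metric.mem_eball, edist_eq_enorm_sub, sub_zero, ← edist_eq_enorm_sub]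
    have h1 := hp.hasSum_iteratedFDeriv hw'
    rw [add_sub_cancel] at h1
    have h2 := hasSum_single (f := fun n : ℕ => ((n.factorial : ℝ))⁻¹ •
      (iteratedFDeriv ℝ n g x) fun _ => w - x) 0 fun n hn => by
        rw [h n (Nat.one_le_iff_ne_zero.2 hn)]
        simp
    simpa using h1.unique h2
  exact hg.eqOn_of_preconnected_of_eventuallyEq analyticOnNhd_const hU hx hev hy

variable {W : Type*} [NormedAddCommGroup W] [NormedSpace ℝ W]

theorem AnalyticAt.continuousAt_iteratedFDeriv [CompleteSpace W] {f : E → W} {x : E}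
    (hf : AnalyticAt ℝ f x) (j : ℕ) : ContinuousAt (iteratedFDeriv ℝ j f) x :=
  (AnalyticOnNhd.iteratedFDeriv (s := {x}) (by simpa [AnalyticOnNhd] using hf) j x
    rfl).continuousAt

theorem AnalyticAt.iteratedFDeriv_clm_comp [CompleteSpace W] {f : E → W} {x : E} (hf : AnalyticAt ℝ f x)
    (φ : W →L[ℝ] ℝ) (j : ℕ) : iteratedFDeriv ℝ j (φ ∘ f) x =
      φ.compContinuousMultilinearMap (iteratedFDeriv ℝ j f x) :=
  φ.iteratedFDeriv_comp_left (n := j) hf.contDiffAt le_rfl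

/-- A lower bound for jets of the functions `φ ∘ f`, uniform over functionals `φ` in a subspace. -/
theorem exists_eventually_le_norm_iteratedFDeriv [FiniteDimensional ℝ W] {f : E → W} {x₀ : E}
    (hf : AnalyticAt ℝ f x₀) (Z : Submodule ℝ (W →L[ℝ] ℝ))
    (hZ : ∀ φ ∈ Z, φ ≠ 0 → ∃ j, iteratedFDeriv ℝ j (φ ∘ f) x₀ ≠ 0) :
    ∃ (l : ℕ) (a : ℝ), 0 < a ∧ ∀ᶠ x in nhds x₀, ∀ φ ∈ Z, ∃ j ≤ l,
      a * ‖φ‖ ≤ ‖iteratedFDeriv ℝ j (φ ∘ f) x‖ := by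
  have hW : CompleteSpace W := FiniteDimensional.complete ℝ W
  have hcompact : IsCompact (Metric.sphere (0 : W →L[ℝ] ℝ) 1 ∩ Z) :=
    (isCompact_sphere _ _).inter_right Z.closed_of_finiteDimensional
  have key : ∃ (l : ℕ) (a : ℝ), 0 < a ∧ ∀ᶠ x in nhds x₀,
      ∀ φ ∈ Metric.sphere (0 : W →L[ℝ] ℝ) 1 ∩ Z, ∃ j ≤ l,
      a ≤ ‖φ.compContinuousMultilinearMap (iteratedFDeriv ℝ j f x)‖ := by
    refine hcompact.induction_on
      (p := fun S : Set (W →L[ℝ] ℝ) => ∃ (l : ℕ) (a : ℝ), 0 < a ∧ ∀ᶠ x in nhds x₀,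
      ∀ φ ∈ S, ∃ j ≤ l, a ≤ ‖φ.compContinuousMultilinearMap (iteratedFDeriv ℝ j f x)‖) ?_ ?_ ?_ ?_
    · exact ⟨0, 1, one_pos, by simp⟩
    · rintro S T hST ⟨l, a, ha, h⟩
      exact ⟨l, a, ha, h.mono fun x hx φ hφ => hx φ (hST hφ)⟩
    · rintro S T ⟨l, a, ha, h⟩ ⟨l', a', ha', h'⟩
      refine ⟨max l l', min a a', lt_min ha ha', ?_⟩
      filter_upwards [h, h'] with x hx hx' φ hφ
      rcases hφ with hφ | hφ
      · obtain ⟨j, hj, hle⟩ := hx φ hφ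
        exact ⟨j, le_max_of_le_left hj, (min_le_left _ _).trans hle⟩
      · obtain ⟨j, hj, hle⟩ := hx' φ hφ
        exact ⟨j, le_max_of_le_right hj, (min_le_right _ _).trans hle⟩
    · rintro φ₀ ⟨hφ1, hφZ⟩
      have hφ0 : φ₀ ≠ 0 := by
        rintro rfl
        simp at hφ1
      obtain ⟨j, hj⟩ := hZ φ₀ hφZ hφ0
      rw [hf.iteratedFDeriv_clm_comp] at hj
      set c := ‖φ₀.compContinuousMultilinearMap (iteratedFDeriv ℝ j f x₀)‖ with hc
      have hc0 : 0 < c := norm_pos_iff.2 hj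
      have hcont : ContinuousAt (fun p : (W →L[ℝ] ℝ) × E =>
          ‖p.1.compContinuousMultilinearMap (iteratedFDeriv ℝ j f p.2)‖) (φ₀, x₀) := by
        have h1 : ContinuousAt (fun p : (W →L[ℝ] ℝ) × E => iteratedFDeriv ℝ j f p.2) (φ₀, x₀) :=
          ContinuousAt.comp (f := Prod.snd) (hf.continuousAt_iteratedFDeriv j) continuousAt_snd
        have h2 : ContinuousAt (fun p : (W →L[ℝ] ℝ) × E =>
            ContinuousLinearMap.compContinuousMultilinearMapL ℝ (fun _ : Fin j => E) W ℝ p.1)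
            (φ₀, x₀) :=
          (ContinuousLinearMap.continuous _).continuousAt.comp continuousAt_fst
        exact (h2.clm_apply h1).norm
      have hev := hcont.eventually (lt_mem_nhds (half_lt_self hc0))
      rw [nhds_prod_eq] at hev
      obtain ⟨T, hT, V, hV, hTV⟩ := Filter.mem_prod_iff.1 hev
      refine ⟨T, mem_nhdsWithin_of_mem_nhds hT, j, c / 2, by positivity, ?_⟩
      filter_upwards [hV] with x hx φ hφ
      exact ⟨j, le_rfl, (hTV (Set.mk_mem_prod hφ hx)).le⟩
  obtain ⟨l, a, ha, h⟩ := key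
  refine ⟨l, a, ha, ?_⟩
  filter_upwards [h, hf.eventually_analyticAt] with x hx hfx φ hφ
  rcases eq_or_ne φ 0 with rfl | hφ0
  · exact ⟨0, Nat.zero_le _, by simp⟩
  have hn : 0 < ‖φ‖ := norm_pos_iff.2 hφ0
  obtain ⟨j, hj, hle⟩ := hx (‖φ‖⁻¹ • φ) ⟨by simp [norm_smul, hn.ne'], Z.smul_mem _ hφ⟩
  refine ⟨j, hj, ?_⟩
  have hsmul : (‖φ‖⁻¹ • φ).compContinuousMultilinearMap (iteratedFDeriv ℝ j f x) =
      ‖φ‖⁻¹ • φ.compContinuousMultilinearMap (iteratedFDeriv ℝ j f x) := rfl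
  rw [hsmul, norm_smul, norm_inv, norm_norm, inv_mul_eq_div, le_div_iff₀ hn] at hle
  rwa [hfx.iteratedFDeriv_clm_comp]

theorem radius_le_of_ball_subset_ball [Nontrivial E] {x z : E} {ρ r : ℝ} (hρ : 0 < ρ)
    (h : Metric.ball z ρ ⊆ Metric.ball x r) : ρ ≤ r := by
  obtain ⟨e, he⟩ := exists_norm_eq E zero_le_one
  refine le_of_forall_lt_imp_le_of_dense fun t ht => ?_
  rcases le_or_gt t 0 with ht0 | ht0
  · exact ht0.trans (Metric.pos_of_mem_ball (h (Metric.mem_ball_self hρ))).le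
  have hmem : ∀ c : ℝ, |c| = t → z + c • e ∈ Metric.ball x r := fun c hc =>
    h (by rw [mem_ball_iff_norm, add_sub_cancel_left, norm_smul, he, Real.norm_eq_abs, hc]; linarith)
  have h1 := hmem t (abs_of_pos ht0)
  have h2 := hmem (-t) (by rw [abs_neg, abs_of_pos ht0])
  rw [Metric.mem_ball] at h1 h2
  have h3 := dist_triangle_right (z + t • e) (z + -t • e) x
  have h4 : dist (z + t • e) (z + -t • e) = 2 * t := by
    rw [dist_add_left, dist_eq_norm, ← sub_smul, norm_smul, he, Real.norm_eq_abs,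
      abs_of_pos (by linarith)]
    ring
  linarith

variable [MeasurableSpace E] [BorelSpace E] [FiniteDimensional ℝ E] (μ : Measure E)
  [μ.IsAddHaarMeasure]

/-- Linear functionals of an analytic map satisfy a uniform sublevel estimate on all small balls. -/
theorem exists_measure_sublevel_clm_comp_le [FiniteDimensional ℝ W] {f : E → W} {U : Set E}
    (hU : IsOpen U) (hUc : IsPreconnected U) (hf : AnalyticOnNhd ℝ f U) {x₀ : E} (hx₀ : x₀ ∈ U) :
    ∃ r : ℝ, 0 < r ∧ Metric.ball x₀ r ⊆ U ∧ ∃ C : ℝ, 0 < C ∧ ∃ α : ℝ, 0 < α ∧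
      ∀ (φ : W →L[ℝ] ℝ) (z : E) (ρ : ℝ), 0 < ρ → Metric.ball z ρ ⊆ Metric.ball x₀ r →
      ∀ ε : ℝ, 0 < ε →
      μ {x ∈ Metric.ball z ρ | |φ (f x)| < ε * sSup ((fun y => |φ (f y)|) '' Metric.ball z ρ)} ≤
        ENNReal.ofReal (C * ε ^ α) * μ (Metric.ball z ρ) := by
  let Z : Submodule ℝ (W →L[ℝ] ℝ) :=
    { carrier := {φ | ∀ x ∈ U, φ (f x) = 0}
      add_mem' := fun {φ ψ} hφ hψ x hx => by simp [hφ x hx, hψ x hx]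
      zero_mem' := fun x _ => by simp
      smul_mem' := fun c φ hφ x hx => by simp [hφ x hx] }
  obtain ⟨Z', hZ'⟩ := Z.exists_isCompl
  have hjet : ∀ φ ∈ Z', φ ≠ 0 → ∃ j, iteratedFDeriv ℝ j (φ ∘ f) x₀ ≠ 0 := by
    intro φ hφ hφ0
    by_contra! hall
    refine hφ0 (Submodule.disjoint_def.1 hZ'.disjoint φ (fun x hx => ?_) hφ)
    have h0 : φ (f x₀) = 0 := by
      have := congrArg norm (hall 0)
      rwa [norm_iteratedFDeriv_zero, norm_zero, norm_eq_zero] at this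
    rw [← h0]
    exact (φ.comp_analyticOnNhd hf).eq_of_iteratedFDeriv_eq_zero hUc hx₀ (fun j _ => hall j) hx
  have hW : CompleteSpace W := FiniteDimensional.complete ℝ W
  obtain ⟨l, a, ha, hlow⟩ := exists_eventually_le_norm_iteratedFDeriv (hf x₀ hx₀) Z' hjet
  set A := ‖iteratedFDeriv ℝ (l + 1) f x₀‖ + 1 with hA
  have hA0 : 0 < A := by positivity
  have hup : ∀ᶠ x in nhds x₀, ‖iteratedFDeriv ℝ (l + 1) f x‖ < A :=
    ((hf x₀ hx₀).continuousAt_iteratedFDeriv (l + 1)).norm.eventually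
      (gt_mem_nhds (lt_add_one _))
  obtain ⟨r₀, hr₀, hball⟩ := Metric.eventually_nhds_iff_ball.1
    ((hlow.and hup).and (hU.mem_nhds hx₀))
  obtain ⟨C, hC, α, hα, hgood⟩ :=
    exists_measure_sublevel_le μ l (K := A / a) (by positivity)
  have hsub : Metric.ball x₀ (min r₀ 1) ⊆ Metric.ball x₀ r₀ :=
    Metric.ball_subset_ball (min_le_left _ _)
  refine ⟨min r₀ 1, by positivity, fun x hx => (hball x (hsub hx)).2, C, hC, α, hα, ?_⟩
  intro φ z ρ hρ hρr ε hε
  obtain ⟨ρ', hρ', hρ'1, hBρ⟩ : ∃ ρ' : ℝ, 0 < ρ' ∧ ρ' ≤ 1 ∧ Metric.ball z ρ = Metric.ball z ρ' := by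
    rcases subsingleton_or_nontrivial E with hE | hE
    · exact ⟨1, one_pos, le_rfl, by
        ext x
        rw [Subsingleton.elim x z]
        simp [hρ]⟩
    · exact ⟨ρ, hρ, (radius_le_of_ball_subset_ball hρ hρr).trans (min_le_right _ _), rfl⟩
  rw [hBρ] at hρr ⊢
  have hB : ∀ x ∈ Metric.ball z ρ', x ∈ U := fun x hx => (hball x (hsub (hρr hx))).2
  obtain ⟨φ₁, hφ₁, φ₂, hφ₂, rfl⟩ := Submodule.mem_sup.1
    (show φ ∈ Z ⊔ Z' by rw [hZ'.sup_eq_top]; trivial)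
  have heq : ∀ x ∈ Metric.ball z ρ', |(φ₁ + φ₂) (f x)| = |(φ₂ ∘ f) x| := by
    intro x hx
    have : φ₁ (f x) = 0 := hφ₁ x (hB x hx)
    simp [this]
  have himage : (fun y => |(φ₁ + φ₂) (f y)|) '' Metric.ball z ρ' =
      (fun y => |(φ₂ ∘ f) y|) '' Metric.ball z ρ' := Set.image_congr heq
  have hset : {x ∈ Metric.ball z ρ' | |(φ₁ + φ₂) (f x)| <
      ε * sSup ((fun y => |(φ₁ + φ₂) (f y)|) '' Metric.ball z ρ')} =
      {x ∈ Metric.ball z ρ' | |(φ₂ ∘ f) x| <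
      ε * sSup ((fun y => |(φ₂ ∘ f) y|) '' Metric.ball z ρ')} := by
    ext x
    rw [himage]
    exact and_congr_right fun hx => by rw [heq x hx]
  rw [hset]
  rcases eq_or_ne φ₂ 0 with rfl | hφ0
  · refine (measure_mono_null (t := ∅) (Set.subset_empty_iff.2 ?_) measure_empty).trans_le bot_le
    rw [Set.eq_empty_iff_forall_notMem]
    rintro x ⟨hx, hlt⟩
    have him : (fun y => |((0 : W →L[ℝ] ℝ) ∘ f) y|) '' Metric.ball z ρ' = {0} := by
      simpa using Set.Nonempty.image_const ⟨x, hx⟩ (0 : ℝ)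
    rw [him, csSup_singleton, mul_zero] at hlt
    exact (abs_nonneg _).not_gt hlt
  · have hn : 0 < ‖φ₂‖ := norm_pos_iff.2 hφ0
    refine hgood (φ₂ ∘ f) z ρ' (a * ‖φ₂‖) hρ' hρ'1 (by positivity)
      (φ₂.comp_analyticOnNhd fun x hx => hf x (hB x hx))
      (fun x hx => (hball x (hsub (hρr hx))).1.1 φ₂ hφ₂) (fun x hx => ?_) ε hε
    rw [(hf x (hB x hx)).iteratedFDeriv_clm_comp]
    calc _ ≤ ‖φ₂‖ * ‖iteratedFDeriv ℝ (l + 1) f x‖ :=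
          ContinuousLinearMap.norm_compContinuousMultilinearMap_le _ _
      _ ≤ ‖φ₂‖ * A := by
        gcongr
        exact (hball x (hsub (hρr hx))).1.2.le
      _ = A / a * (a * ‖φ₂‖) := by field_simp

end Analytic

theorem AnalyticOnNhd.nondegAt_affineSpan {d n : ℕ} {U : Set (Fin d → ℝ)} (hU : IsOpen U)
    (hUc : IsPreconnected U) {f : (Fin d → ℝ) → Fin n → ℝ} (hf : AnalyticOnNhd ℝ f U)
    {x : Fin d → ℝ} (hx : x ∈ U) : NondegAt U (affineSpan ℝ (f '' U)) f x := by
  let S : ℕ →o Submodule ℝ (Fin n → ℝ) :=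
    { toFun := fun l => Submodule.span ℝ {y : Fin n → ℝ | ∃ m : ℕ, 1 ≤ m ∧ m ≤ l ∧
        ∃ u : Fin m → (Fin d → ℝ), y = iteratedFDerivWithin ℝ m f U x u}
      monotone' := fun k l hkl => Submodule.span_mono fun y ⟨m, h1, h2, hy⟩ =>
        ⟨m, h1, h2.trans hkl, hy⟩ }
  obtain ⟨l, hl⟩ := monotone_stabilizes_iff_noetherian.2
    (inferInstance : IsNoetherian ℝ (Fin n → ℝ)) S
  have hwithin : ∀ m, iteratedFDerivWithin ℝ m f U x = iteratedFDeriv ℝ m f x := fun m =>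
    iteratedFDerivWithin_of_isOpen m hU hx
  refine ⟨l, ?_⟩
  change S l = _
  rw [direction_affineSpan]
  refine le_antisymm (Submodule.span_le.2 ?_) ?_
  · rintro y ⟨m, hm1, -, u, rfl⟩
    by_contra hy
    obtain ⟨ψ, hψ, hker⟩ := Submodule.exists_le_ker_of_notMem hy
    set φ : (Fin n → ℝ) →L[ℝ] ℝ := ψ.toContinuousLinearMap
    refine hψ ?_
    have hconst : φ ∘ f =ᶠ[nhds x] fun _ => ψ (f x) := by
      filter_upwards [hU.mem_nhds hx] with w hw
      have h1 : f w -ᵥ f x ∈ vectorSpan ℝ (f '' U) :=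
        vsub_mem_vectorSpan ℝ (Set.mem_image_of_mem f hw) (Set.mem_image_of_mem f hx)
      have h2 : ψ (f w - f x) = 0 := hker h1
      rw [map_sub, sub_eq_zero] at h2
      exact h2
    have h3 := (hf x hx).iteratedFDeriv_clm_comp φ m
    rw [(hconst.iteratedFDeriv ℝ m).eq_of_nhds, iteratedFDeriv_const_of_ne (by omega)] at h3
    rw [hwithin]
    exact (DFunLike.congr_fun h3 u).symm
  · intro v hv
    by_contra hvS
    obtain ⟨ψ, hψ, hker⟩ := Submodule.exists_le_ker_of_notMem hvS
    set φ : (Fin n → ℝ) →L[ℝ] ℝ := ψ.toContinuousLinearMap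
    have hjet : ∀ j, 1 ≤ j → iteratedFDeriv ℝ j (φ ∘ f) x = 0 := by
      intro j hj
      rw [(hf x hx).iteratedFDeriv_clm_comp]
      ext u
      have hmem : iteratedFDeriv ℝ j f x u ∈ S (max l j) :=
        Submodule.subset_span ⟨j, hj, le_max_right _ _, u, by rw [hwithin]⟩
      rw [← hl _ (le_max_left _ _)] at hmem
      exact hker hmem
    have hconst : ∀ w ∈ U, ψ (f w) = ψ (f x) := fun w hw =>
      (φ.comp_analyticOnNhd hf).eq_of_iteratedFDeriv_eq_zero hUc hx hjet hw
    have hle : vectorSpan ℝ (f '' U) ≤ LinearMap.ker ψ := by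
      rw [vectorSpan_def, Submodule.span_le]
      rintro _ ⟨_, ⟨w, hw, rfl⟩, _, ⟨w', hw', rfl⟩, rfl⟩
      simp [hconst w hw, hconst w' hw']
    exact hψ (hle hv)

theorem AnalyticOnNhd.goodAt {d n : ℕ} {U : Set (Fin d → ℝ)} (hU : IsOpen U)
    (hUc : IsPreconnected U) {f : (Fin d → ℝ) → Fin n → ℝ} (hf : AnalyticOnNhd ℝ f U)
    {x : Fin d → ℝ} (hx : x ∈ U) : GoodAt U f x := by
  obtain ⟨r, hr, hrU, C, hC, α, hα, h⟩ := exists_measure_sublevel_clm_comp_le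
    (volume : Measure (Fin d → ℝ)) (f := fun x => ((1 : ℝ), f x)) hU hUc
    (analyticOnNhd_const.prod hf) hx
  refine ⟨Metric.ball x r, Metric.ball_mem_nhds x hr, hrU, C, hC, α, hα, ?_⟩
  intro c₀ c z ρ hρ hsub ε hε
  have := h (c₀ • ContinuousLinearMap.fst ℝ ℝ (Fin n → ℝ) +
    ∑ i, c i • (ContinuousLinearMap.proj i).comp (ContinuousLinearMap.snd ℝ ℝ (Fin n → ℝ)))
    z ρ hρ hsub ε hε
  simpa [sum_apply] using this

/-- **Corollary 3.3.** Let `f` be a real analytic map from a connected open subset `U` of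
`ℝ^d` to `ℝ^n`. Then there exists an affine subspace `L` of `ℝ^n` such that `f` takes values
in `L` and `f` is nondegenerate in `L` at every point of `U`; consequently, `f` is good at
every point of `U`. -/
theorem analytic_nondeg_in_some_subspace (d n : ℕ) (U : Set (Fin d → ℝ))
    (hU : IsOpen U) (hUconn : IsConnected U)
    (f : (Fin d → ℝ) → Fin n → ℝ) (hf : AnalyticOnNhd ℝ f U) :
    ∃ L : AffineSubspace ℝ (Fin n → ℝ),
      (∀ x ∈ U, f x ∈ L) ∧ (∀ x ∈ U, NondegAt U L f x) ∧ (∀ x ∈ U, GoodAt U f x) := by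
  exact ⟨affineSpan ℝ (f '' U), fun x hx => subset_affineSpan ℝ _ (Set.mem_image_of_mem f hx),
    fun x hx => hf.nondegAt_affineSpan hU hUconn.isPreconnected hx,
    fun x hx => hf.goodAt hU hUconn.isPreconnected hx⟩
end

section
/- Let B = B(x_0, r) be a ball in ℝ^d and let f = (f_1,...,f_n) be a continuous map from 3^{n+1}B = B(x_0, 3^{n+1} r) to ℝ^n. Suppose that: (i) there exist C, α > 0 such that every linear combination c_0 + c_1 f_1 + ... + c_n f_n (c_i ∈ ℝ) is (C,α)-good on 3^{n+1}B; (ii) the ball B and the map f satisfy condition [3.6-ii]. Then f(x) is not VWA for almost every x ∈ B. -/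
open MeasureTheory

/-- `y ∈ W_v(1,n)`: infinitely many `q ∈ ℤ^n` with `|y·q + p| ≤ ‖q‖^{-v}` for some `p ∈ ℤ`. -/
def InW {n : ℕ} (y : Fin n → ℝ) (v : ℝ) : Prop :=
  {q : Fin n → ℤ | ∃ p : ℤ,
    |(∑ i, y i * (q i : ℝ)) + (p : ℝ)| ≤
      ‖(fun i => (q i : ℝ) : Fin n → ℝ)‖ ^ (-v)}.Infinite

/-- `y` is very well approximable. -/
def IsVWA {n : ℕ} (y : Fin n → ℝ) : Prop :=
  ∃ v : ℝ, (n : ℝ) < v ∧ InW y v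

/-- `f` is extremal on `U`: `f x` is not VWA for a.e. `x ∈ U`. -/
def IsExtremal {α : Type*} [MeasureSpace α] {n : ℕ} (U : Set α) (f : α → Fin n → ℝ) : Prop :=
  volume {x ∈ U | IsVWA (f x)} = 0

open MeasureTheory

/-- The `I`-th coordinate (in the basis `e_I`) of `v₁ ∧ … ∧ v_j`, i.e. the `j×j` minor
determinant of the matrix with rows `v₁,…,v_j` and columns indexed by `I`. -/
noncomputable def minorDet {k j : ℕ} (v : Fin j → Fin k → ℤ) (I : Finset (Fin k)) : ℤ :=
  if h : I.card = j then
    Matrix.det (Matrix.of fun a b : Fin j => v a ((I.orderIsoOfFin h) b : Fin k))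
  else 0

/-- `w` (given by its coordinates in the basis `(e_I)_{|I|=j}` of `Λ^j(ℝ^k)`) belongs to
`S_{k,j}`: it represents a rank-`j` subgroup of `ℤ^k`, i.e. `w = v₁ ∧ … ∧ v_j` for some
`ℤ`-basis `v₁,…,v_j` of such a subgroup (equivalently, a `ℤ`-linearly independent family). -/
def IsPrim {k : ℕ} (j : ℕ) (w : Finset (Fin k) → ℝ) : Prop :=
  ∃ v : Fin j → (Fin k → ℤ), LinearIndependent ℤ v ∧
    ∀ I : Finset (Fin k), w I = (minorDet v I : ℝ)

/-- The action of `g ∈ GL_k(ℝ)` on `Λ(ℝ^k)` in basis coordinates: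
`((Λ g) w)_I = ∑_{|J| = |I|} det(g_{I,J}) w_J` (compound matrix formula). -/
noncomputable def extAction {k : ℕ} (g : Matrix (Fin k) (Fin k) ℝ)
    (w : Finset (Fin k) → ℝ) : Finset (Fin k) → ℝ := fun I =>
  ∑ J : Finset (Fin k),
    if hJ : J.card = I.card then
      (Matrix.det (Matrix.of fun a b : Fin I.card =>
        g ((I.orderIsoOfFin rfl) a : Fin k) ((J.orderIsoOfFin hJ) b : Fin k))) * w J
    else 0

/-- The sup norm `max_I |w_I|` on `Λ(ℝ^k)`. -/
noncomputable def multiNorm {k : ℕ} (w : Finset (Fin k) → ℝ) : ℝ :=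
  ⨆ I : Finset (Fin k), |w I|

/-- The matrix `g_t = diag(e^t, e^{-t/n}, …, e^{-t/n})`. -/
noncomputable def gMat (n : ℕ) (t : ℝ) : Matrix (Fin (n + 1)) (Fin (n + 1)) ℝ :=
  Matrix.diagonal (Fin.cons (Real.exp t) fun _ => Real.exp (-t / (n : ℝ)))

/-- The matrix `u_y` with first row `(1, y)` and remaining rows `(0, I_n)`. -/
def uMat {n : ℕ} (y : Fin n → ℝ) : Matrix (Fin (n + 1)) (Fin (n + 1)) ℝ :=
  Matrix.of (Fin.cons (Fin.cons 1 y) fun i => Fin.cons 0 fun j => if i = j then 1 else 0)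

/-- Condition [3.6-ii] for a set `B` and map `f : B → ℝ^n`: for every `β > 0` there is
`T > 0` such that for every `t ≥ T` and every `Γ ∈ S_{n+1}` (represented by `w`),
`sup_{x ∈ B} ‖g_t u_{f(x)} Γ‖ ≥ e^{-βt}`. -/
def Cond36ii {d n : ℕ} (B : Set (Fin d → ℝ)) (f : (Fin d → ℝ) → Fin n → ℝ) : Prop :=
  ∀ β : ℝ, 0 < β → ∃ T : ℝ, 0 < T ∧ ∀ t : ℝ, T ≤ t →
    ∀ j : ℕ, 1 ≤ j → j ≤ n → ∀ w : Finset (Fin (n + 1)) → ℝ, IsPrim j w →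
      Real.exp (-β * t) ≤
        sSup ((fun x => multiNorm (extAction (gMat n t * uMat (f x)) w)) '' B)

/-- The `m × m` minor, on the columns `c`, of the matrix with rows `u`, as an alternating map
of the rows. -/
noncomputable def colMinor {k m : ℕ} (c : Fin m → Fin k) :
    (Fin k → ℝ) [⋀^Fin m]→ₗ[ℝ] ℝ :=
  Matrix.detRowAlternating.compLinearMap (LinearMap.funLeft ℝ ℝ c)

lemma colMinor_apply {k m : ℕ} (c : Fin m → Fin k) (u : Fin m → Fin k → ℝ) :
    colMinor c u = Matrix.det (Matrix.of fun a b => u a (c b)) := rfl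

/-- **Cauchy–Binet formula**, for the rows `A uₐ`. -/
lemma det_mulVec_eq_sum_minors {k m : ℕ} (A : Matrix (Fin m) (Fin k) ℝ)
    (u : Fin m → Fin k → ℝ) :
    Matrix.det (Matrix.of fun a => A.mulVec (u a)) =
      ∑ J : Finset (Fin k), if hJ : J.card = m then
        Matrix.det (Matrix.of fun a b : Fin m => A a (J.orderEmbOfFin hJ b)) *
          colMinor (J.orderEmbOfFin hJ) u else 0 := by
  classical
  let F : (Fin k → ℝ) [⋀^Fin m]→ₗ[ℝ] ℝ :=
    Matrix.detRowAlternating.compLinearMap A.mulVecLin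
  let G : (Fin k → ℝ) [⋀^Fin m]→ₗ[ℝ] ℝ :=
    ∑ J : Finset (Fin k), if hJ : J.card = m then
      Matrix.det (Matrix.of fun a b : Fin m => A a (J.orderEmbOfFin hJ b)) •
        colMinor (J.orderEmbOfFin hJ) else 0
  have hG : ∀ w, G w = ∑ J : Finset (Fin k), if hJ : J.card = m then
        Matrix.det (Matrix.of fun a b : Fin m => A a (J.orderEmbOfFin hJ b)) *
          colMinor (J.orderEmbOfFin hJ) w else 0 := by
    intro w
    let ev : ((Fin k → ℝ) [⋀^Fin m]→ₗ[ℝ] ℝ) →+ ℝ :=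
      { toFun := fun H => H w, map_zero' := rfl, map_add' := fun _ _ => rfl }
    change ev G = _
    rw [map_sum]
    refine Finset.sum_congr rfl fun J _ => ?_
    split_ifs <;> simp [ev]
  have key : ∀ c : Fin m → Fin k, StrictMono c →
      F (Pi.basisFun ℝ (Fin k) ∘ c) = G (Pi.basisFun ℝ (Fin k) ∘ c) := by
    intro c hc
    have hcard : (Finset.univ.image c).card = m := by
      rw [Finset.card_image_of_injective _ hc.injective]; simp
    rw [hG, Finset.sum_eq_single (Finset.univ.image c)]
    · rw [dif_pos hcard]
      have hce : c = (Finset.univ.image c).orderEmbOfFin hcard :=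
        Finset.orderEmbOfFin_unique hcard (by simp) hc
      rw [← hce]
      have h1 : colMinor c (Pi.basisFun ℝ (Fin k) ∘ c) = 1 := by
        rw [colMinor_apply, ← Matrix.det_one (n := Fin m)]
        congr 1
        ext a b
        simp [Matrix.one_apply, Pi.single_apply, hc.injective.eq_iff, eq_comm]
      rw [h1, mul_one, ← Matrix.det_transpose]
      change Matrix.det _ = _
      congr 1
      ext a b
      simp [Matrix.col_apply]
    · intro J _ hJ
      split_ifs with h
      · have : ∃ a, c a ∉ J := by
          by_contra! hall
          exact hJ (Finset.eq_of_subset_of_card_le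
            (by intro x hx; simp at hx; obtain ⟨a, rfl⟩ := hx; exact hall a)
            (by rw [h, hcard])).symm
        obtain ⟨a, ha⟩ := this
        have h0 : colMinor (J.orderEmbOfFin h) (Pi.basisFun ℝ (Fin k) ∘ c) = 0 := by
          rw [colMinor_apply]
          refine Matrix.det_eq_zero_of_row_eq_zero a fun b => ?_
          have hne : J.orderEmbOfFin h b ≠ c a := fun e =>
            ha (e ▸ Finset.orderEmbOfFin_mem J h b)
          simp [Pi.single_apply, hne]
        rw [h0, mul_zero]
      · rfl
    · simp
  have hFG : F = G := by
    refine Module.Basis.ext_alternating (Pi.basisFun ℝ (Fin k)) fun v hv => ?_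
    have hs : StrictMono (v ∘ Tuple.sort v) :=
      (Tuple.monotone_sort v).strictMono_of_injective (hv.comp (Tuple.sort v).injective)
    have h2 := key _ hs
    rw [← Function.comp_assoc, AlternatingMap.map_perm, AlternatingMap.map_perm] at h2
    change F (Pi.basisFun ℝ (Fin k) ∘ v) = G (Pi.basisFun ℝ (Fin k) ∘ v)
    rcases Int.units_eq_one_or (Equiv.Perm.sign (Tuple.sort v)) with h | h <;>
      simpa only [h, one_smul, Units.neg_smul, neg_inj] using h2
  rw [← hG, ← hFG]
  rfl

/-- The coordinates of `g (v₁ ∧ … ∧ v_j)` are the minors of the vectors `g vₐ`. -/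
lemma extAction_minorDet {k j : ℕ} (g : Matrix (Fin k) (Fin k) ℝ) (v : Fin j → Fin k → ℤ)
    (I : Finset (Fin k)) :
    extAction g (fun J => (minorDet v J : ℝ)) I =
      if h : I.card = j then
        colMinor (I.orderEmbOfFin h) (fun a => g.mulVec fun i => (v a i : ℝ)) else 0 := by
  unfold extAction
  split_ifs with h
  · subst h
    rw [colMinor_apply]
    have := det_mulVec_eq_sum_minors
      (Matrix.of fun a b => g (I.orderEmbOfFin rfl a) b) (fun a i => (v a i : ℝ))
    refine Eq.trans ?_ this.symm
    refine Finset.sum_congr rfl fun J _ => ?_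
    split_ifs with hJ
    · simp only [Finset.coe_orderIsoOfFin_apply, minorDet, dif_pos hJ, colMinor_apply,
        Matrix.of_apply]
      congr 1
      rw [Int.cast_det]
      rfl
    · rfl
  · refine Finset.sum_eq_zero fun J _ => ?_
    split_ifs with hJ
    · simp [minorDet, hJ, h]
    · rfl

lemma abs_le_multiNorm {k : ℕ} (w : Finset (Fin k) → ℝ) (I : Finset (Fin k)) :
    |w I| ≤ multiNorm w :=
  le_ciSup (f := fun I => |w I|) (Set.finite_range _).bddAbove I

lemma exists_multiNorm_eq {k : ℕ} (w : Finset (Fin k) → ℝ) : ∃ I, |w I| = multiNorm w :=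
  exists_eq_ciSup_of_finite (f := fun I => |w I|)

/-- The norm of `g (v₁ ∧ … ∧ v_j)`. -/
noncomputable def wedgeNorm {k j : ℕ} (g : Matrix (Fin k) (Fin k) ℝ) (v : Fin j → Fin k → ℤ) :
    ℝ :=
  multiNorm (extAction g fun J => (minorDet v J : ℝ))

lemma abs_colMinor_le_wedgeNorm {k j : ℕ} (g : Matrix (Fin k) (Fin k) ℝ)
    (v : Fin j → Fin k → ℤ) (c : Fin j → Fin k) (hc : StrictMono c) :
    |colMinor c (fun a => g.mulVec fun i => (v a i : ℝ))| ≤ wedgeNorm g v := by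
  classical
  have hcard : (Finset.univ.image c).card = j := by
    rw [Finset.card_image_of_injective _ hc.injective]; simp
  have hce : c = (Finset.univ.image c).orderEmbOfFin hcard :=
    Finset.orderEmbOfFin_unique hcard (by simp) hc
  have := abs_le_multiNorm (extAction g fun J => (minorDet v J : ℝ)) (Finset.univ.image c)
  rwa [extAction_minorDet, dif_pos hcard, ← hce] at this

lemma wedgeNorm_le {k j : ℕ} (g : Matrix (Fin k) (Fin k) ℝ)
    (v : Fin j → Fin k → ℤ) {M : ℝ} (hM : 0 ≤ M)
    (h : ∀ c : Fin j → Fin k, StrictMono c →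
      |colMinor c (fun a => g.mulVec fun i => (v a i : ℝ))| ≤ M) :
    wedgeNorm g v ≤ M := by
  obtain ⟨I, hI⟩ := exists_multiNorm_eq (extAction g fun J => (minorDet v J : ℝ))
  rw [wedgeNorm, ← hI, extAction_minorDet]
  split_ifs with hc
  · exact h _ (I.orderEmbOfFin hc).strictMono
  · simpa using hM

/-- `‖v ∧ w‖ ≤ (j + 1) ‖v‖ ‖w‖` for a vector `v` and a decomposable `j`-vector `w`. -/
lemma wedgeNorm_cons_le {k j : ℕ} (g : Matrix (Fin k) (Fin k) ℝ)
    (v : Fin j → Fin k → ℤ) (u : Fin k → ℤ) {η : ℝ}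
    (hη : ∀ i, |g.mulVec (fun i => (u i : ℝ)) i| ≤ η) (hη0 : 0 ≤ η) :
    wedgeNorm g (Fin.cons u v : Fin (j + 1) → Fin k → ℤ) ≤ (j + 1) * (η * wedgeNorm g v) := by
  have hnn : 0 ≤ wedgeNorm g v := (abs_nonneg _).trans (abs_le_multiNorm _ ∅)
  refine wedgeNorm_le _ _ (by positivity) fun c hc => ?_
  rw [colMinor_apply, Matrix.det_succ_row_zero]
  refine (Finset.abs_sum_le_sum_abs _ _).trans ?_
  have : ((j : ℝ) + 1) * (η * wedgeNorm g v) =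
      ∑ _i : Fin (j + 1), η * wedgeNorm g v := by simp
  rw [this]
  refine Finset.sum_le_sum fun i _ => ?_
  rw [abs_mul, abs_mul, abs_pow, abs_neg, abs_one, one_pow, one_mul]
  refine mul_le_mul (hη _) ?_ (abs_nonneg _) hη0
  exact abs_colMinor_le_wedgeNorm g v (c ∘ i.succAbove) (hc.comp (Fin.strictMono_succAbove i))

/-- Passing to a sublattice does not decrease the norm of the representing multivector. -/
lemma wedgeNorm_le_of_mem_span {k j j' : ℕ} (hj : j' = j) (g : Matrix (Fin k) (Fin k) ℝ)
    (b : Fin j' → Fin k → ℤ) (v : Fin j → Fin k → ℤ) (hv : LinearIndependent ℤ v)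
    (hmem : ∀ a, v a ∈ Submodule.span ℤ (Set.range b)) :
    wedgeNorm g b ≤ wedgeNorm g v := by
  subst hj
  have h1 : ∀ a, ∃ A : Fin j' → ℤ, ∑ i, A i • b i = v a := fun a =>
    (Submodule.mem_span_range_iff_exists_fun ℤ).1 (hmem a)
  choose A hA using h1
  have hdet : (Matrix.of A).det ≠ 0 := by
    intro h0
    obtain ⟨x, hx, hx0⟩ := Matrix.exists_vecMul_eq_zero_iff.2 h0
    refine hx (funext fun a => Fintype.linearIndependent_iff.1 hv x ?_ a)
    simp_rw [← hA, Finset.smul_sum, smul_smul]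
    rw [Finset.sum_comm]
    refine Finset.sum_eq_zero fun i _ => ?_
    rw [← Finset.sum_smul]
    have := congrFun hx0 i
    simp only [Matrix.vecMul, dotProduct, Matrix.of_apply, Pi.zero_apply] at this
    rw [this, zero_smul]
  have hdet1 : (1 : ℝ) ≤ |((Matrix.of A).det : ℝ)| := by
    have := Int.one_le_abs hdet
    exact_mod_cast this
  refine wedgeNorm_le _ _ ((abs_nonneg _).trans (abs_le_multiNorm _ ∅)) fun c hc => ?_
  refine le_trans ?_ (abs_colMinor_le_wedgeNorm g v c hc)
  have hmul : colMinor c (fun a => g.mulVec fun i => (v a i : ℝ)) =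
      ((Matrix.of A).det : ℝ) * colMinor c (fun a => g.mulVec fun i => (b a i : ℝ)) := by
    rw [colMinor_apply, colMinor_apply, Int.cast_det, ← Matrix.det_mul]
    congr 1
    ext a i
    simp only [Matrix.of_apply, Matrix.mul_apply, Matrix.map_apply]
    rw [← hA a]
    simp only [Matrix.mulVec, dotProduct, Finset.sum_apply, Pi.smul_apply, smul_eq_mul,
      Int.cast_sum, Int.cast_mul, Finset.mul_sum]
    rw [Finset.sum_comm]
    exact Finset.sum_congr rfl fun x _ => Finset.sum_congr rfl fun y _ => by ring
  rw [hmul, abs_mul]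
  exact le_mul_of_one_le_left (abs_nonneg _) hdet1

lemma one_le_wedgeNorm_of_det_eq_one {k j : ℕ} (hj : j = k) (g : Matrix (Fin k) (Fin k) ℝ)
    (hg : g.det = 1) (b : Fin j → Fin k → ℤ) (hb : LinearIndependent ℤ b) :
    1 ≤ wedgeNorm g b := by
  subst hj
  have hdet : (Matrix.of b).det ≠ 0 := by
    intro h0
    obtain ⟨x, hx, hx0⟩ := Matrix.exists_vecMul_eq_zero_iff.2 h0
    refine hx (funext fun a => Fintype.linearIndependent_iff.1 hb x ?_ a)
    rw [← hx0]
    ext i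
    simp [Matrix.vecMul, dotProduct]
  have hdet1 : (1 : ℝ) ≤ |((Matrix.of b).det : ℝ)| := by
    have := Int.one_le_abs hdet
    exact_mod_cast this
  refine hdet1.trans ((le_of_eq ?_).trans
    (abs_colMinor_le_wedgeNorm g b id strictMono_id))
  congr 1
  rw [← one_mul ((Matrix.of b).det : ℝ), ← hg, ← Matrix.det_transpose g, mul_comm,
    colMinor_apply, Int.cast_det, ← Matrix.det_mul]
  congr 1
  ext a i
  simp [Matrix.mul_apply, Matrix.mulVec, dotProduct, mul_comm]

lemma wedgeNorm_le_one_of_eq_zero {k j : ℕ} (hj : j = 0) (g : Matrix (Fin k) (Fin k) ℝ)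
    (b : Fin j → Fin k → ℤ) : wedgeNorm g b ≤ 1 := by
  subst hj
  exact wedgeNorm_le _ _ zero_le_one fun c _ => by simp [colMinor_apply]

open Metric Set in
/-- Quantitative nondivergence for a family of functions indexed by a poset of bounded length:
outside of a small set, every point of a ball is marked by some flag. -/
lemma volume_unmarked_le {ι : Type*} (cmp : ι → ι → Prop) (hrefl : ∀ s, cmp s s)
    (hsymm : ∀ s t, cmp s t → cmp t s) {d : ℕ} {ρ ε : ℝ} (hερ : ε ≤ ρ)
    (κ : ENNReal) (ψ : ι → (Fin d → ℝ) → ℝ) (k : ℕ) :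
    ∀ (S : Set ι),
      (∀ F : Finset ι, (∀ s ∈ F, s ∈ S) → (∀ s ∈ F, ∀ t ∈ F, cmp s t) → F.card ≤ k) →
    ∀ (z : Fin d → ℝ) (r : ℝ), 0 < r →
      (∀ s ∈ S, ∀ x ∈ ball z (3 ^ k * r), ∀ t : ℝ, 0 < t → ball x t ⊆ ball z (3 ^ k * r) →
        (∃ y ∈ ball x t, ρ ≤ ψ s y) → volume {y ∈ ball x t | ψ s y < ε} ≤ κ * volume (ball x t)) →
      (∀ s ∈ S, ∀ x ∈ ball z (3 ^ k * r), ψ s x < ρ → ∀ᶠ y in nhds x, ψ s y < ρ) →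
      (∀ s ∈ S, ∃ y ∈ ball z r, ρ ≤ ψ s y) →
      volume {x ∈ ball z r | ¬ ∃ F : Finset ι, (∀ s ∈ F, s ∈ S) ∧ (∀ s ∈ F, ∀ t ∈ F, cmp s t) ∧
        (∀ s ∈ F, ψ s x < ρ) ∧ ∀ s ∈ S, (∀ t ∈ F, cmp s t) → ε ≤ ψ s x} ≤
      (2 * 48 ^ d) ^ k * κ * volume (ball z r) := by
  classical
  have hempty : ∀ (S : Set ι), (∀ s, s ∉ S) → ∀ (z : Fin d → ℝ) (r : ℝ) (M : ENNReal),
      volume {x ∈ ball z r | ¬ ∃ F : Finset ι, (∀ s ∈ F, s ∈ S) ∧ (∀ s ∈ F, ∀ t ∈ F, cmp s t) ∧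
        (∀ s ∈ F, ψ s x < ρ) ∧ ∀ s ∈ S, (∀ t ∈ F, cmp s t) → ε ≤ ψ s x} ≤ M := by
    intro S hemp z r M
    refine le_of_eq_of_le ?_ zero_le
    convert measure_empty (μ := (volume : Measure (Fin d → ℝ)))
    ext x
    simp only [mem_ofPred_eq, mem_empty_iff_false, iff_false, not_and, not_not]
    exact fun _ => ⟨∅, by simp, by simp, by simp, fun s hs => absurd hs (hemp s)⟩
  induction k with
  | zero =>
    intro S hS z r hr _ _ _
    refine hempty S (fun s hs => ?_) z r _
    have := hS {s} (by simpa using hs) (by simpa using hrefl s)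
    simp at this
  | succ k ih =>
    intro S hS z r hr hgood husc hsup
    rcases S.eq_empty_or_nonempty with rfl | ⟨s₀, -⟩
    · exact hempty ∅ (by simp) z r _
    have : Nonempty ι := ⟨s₀⟩
    set V := ball z (3 ^ (k + 1) * r) with hV
    have h3 : (1 : ℝ) ≤ 3 ^ k := one_le_pow₀ (by norm_num)
    have hsubV : ball z r ⊆ V := ball_subset_ball (by
      rw [pow_succ]; nlinarith)
    have hsubV' : ∀ x ∈ ball z r, ∀ t ≤ 2 * r, ball x (3 ^ k * t) ⊆ V := by
      intro x hx t ht
      refine ball_subset_ball' ?_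
      rw [mem_ball] at hx
      rw [pow_succ]
      nlinarith
    -- points where some function is small
    set P := {x ∈ ball z r | ∃ s ∈ S, ψ s x < ρ} with hP
    have hscale : ∀ x ∈ P, ∃ t : ℝ, 0 < t ∧ t ≤ 2 * r ∧
        (∃ s ∈ S, ∀ y ∈ ball x (t / 2), ψ s y < ρ) ∧ ∀ s ∈ S, ∃ y ∈ ball x t, ρ ≤ ψ s y := by
      rintro x ⟨hx, s, hs, hsx⟩
      have hex : ∃ m : ℕ, ∃ s ∈ S, ∀ y ∈ ball x (2 * r * (1 / 2) ^ m), ψ s y < ρ := by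
        obtain ⟨δ, hδ, hδs⟩ := Metric.eventually_nhds_iff_ball.1 (husc s hs x (hsubV hx) hsx)
        obtain ⟨m, hm⟩ := exists_pow_lt_of_lt_one (show 0 < δ / (2 * r) by positivity)
          (show (1 / 2 : ℝ) < 1 by norm_num)
        refine ⟨m, s, hs, fun y hy => hδs y (ball_subset_ball ?_ hy)⟩
        rw [lt_div_iff₀ (by positivity)] at hm
        linarith
      have hfind := Nat.find_spec hex
      have hmin := fun m => Nat.find_min hex (m := m)
      set m := Nat.find hex
      have hm0 : m ≠ 0 := by
        intro h0
        rw [h0] at hfind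
        obtain ⟨s', hs', hall⟩ := hfind
        obtain ⟨y, hy, hρy⟩ := hsup s' hs'
        refine absurd (hall y ?_) (not_lt.2 hρy)
        rw [pow_zero, mul_one, mem_ball]
        rw [mem_ball] at hx hy
        linarith [dist_triangle_right y x z]
      obtain ⟨m', hm'⟩ := Nat.exists_eq_succ_of_ne_zero hm0
      refine ⟨2 * r * (1 / 2) ^ m', by positivity, ?_, ?_, ?_⟩
      · exact mul_le_of_le_one_right (by positivity) (pow_le_one₀ (by norm_num) (by norm_num))
      · rw [hm', pow_succ] at hfind
        convert hfind using 7
        ring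
      · have := hmin m' (by omega)
        push Not at this
        exact this
    choose! t ht0 ht2 hts htsup using hscale
    choose! σ hσS hσ using hts
    obtain ⟨U, hUP, hUd, hUcov⟩ := Vitali.exists_disjoint_subfamily_covering_enlargement_closedBall
      P (fun x => x) (fun x => t x / 16) (2 * r / 16) (fun x hx => by
        have := ht2 x hx; linarith) 4 (by norm_num)
    have hUc : U.Countable := by
      refine hUd.countable_of_nonempty_interior fun x hx => ?_
      refine ⟨x, interior_mono ball_subset_closedBall ?_⟩
      rw [isOpen_ball.interior_eq]
      exact mem_ball_self (by have := ht0 x (hUP hx); positivity)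
    -- the family of elements comparable with `σ x`
    let S' : (Fin d → ℝ) → Set ι := fun x => {s ∈ S | s ≠ σ x ∧ cmp s (σ x)}
    let Bad : (Fin d → ℝ) → Set (Fin d → ℝ) := fun x =>
      {y ∈ ball x (t x) | ¬ ∃ F : Finset ι, (∀ s ∈ F, s ∈ S' x) ∧ (∀ s ∈ F, ∀ t ∈ F, cmp s t) ∧
        (∀ s ∈ F, ψ s y < ρ) ∧ ∀ s ∈ S' x, (∀ t ∈ F, cmp s t) → ε ≤ ψ s y}
    have hBad : ∀ x ∈ P, volume (Bad x) ≤ (2 * 48 ^ d) ^ k * κ * volume (ball x (t x)) := by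
      intro x hx
      have hsub := hsubV' x hx.1 (t x) (ht2 x hx)
      refine ih (S' x) ?_ x (t x) (ht0 x hx) ?_ ?_ ?_
      · intro F hF hFc
        have hnot : σ x ∉ F := fun h => (hF _ h).2.1 rfl
        have := hS (insert (σ x) F) ?_ ?_
        · rw [Finset.card_insert_of_notMem hnot] at this
          omega
        · intro s hs
          rcases Finset.mem_insert.1 hs with rfl | hs
          · exact hσS x hx
          · exact (hF s hs).1
        · intro s hs u hu
          rcases Finset.mem_insert.1 hs with rfl | hs <;>
            rcases Finset.mem_insert.1 hu with rfl | hu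
          · exact hrefl _
          · exact hsymm _ _ (hF u hu).2.2
          · exact (hF s hs).2.2
          · exact hFc s hs u hu
      · intro s hs y hy u hu huV
        exact hgood s hs.1 y (hsub hy) u hu (huV.trans hsub)
      · intro s hs y hy
        exact husc s hs.1 y (hsub hy)
      · intro s hs
        exact htsup x hx s hs.1
    let Low : (Fin d → ℝ) → Set (Fin d → ℝ) := fun x => {y ∈ ball x (t x) | ψ (σ x) y < ε}
    have hLow : ∀ x ∈ P, volume (Low x) ≤ κ * volume (ball x (t x)) := by
      intro x hx
      refine hgood _ (hσS x hx) x (hsubV hx.1) (t x) (ht0 x hx) ?_ (htsup x hx _ (hσS x hx))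
      refine (ball_subset_ball ?_).trans (hsubV' x hx.1 (t x) (ht2 x hx))
      have := ht0 x hx
      nlinarith
    have hcover : {x ∈ ball z r | ¬ ∃ F : Finset ι, (∀ s ∈ F, s ∈ S) ∧
        (∀ s ∈ F, ∀ t ∈ F, cmp s t) ∧
        (∀ s ∈ F, ψ s x < ρ) ∧ ∀ s ∈ S, (∀ t ∈ F, cmp s t) → ε ≤ ψ s x} ⊆
        ⋃ x ∈ U, Bad x ∪ Low x := by
      rintro y ⟨hy, hun⟩
      have hyP : y ∈ P := by
        refine ⟨hy, ?_⟩
        by_contra! hcon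
        exact hun ⟨∅, by simp, by simp, by simp, fun s hs _ => hερ.trans (hcon s hs)⟩
      obtain ⟨x, hxU, hxsub⟩ := hUcov y hyP
      have hxP := hUP hxU
      have htx := ht0 x hxP
      have hyx : y ∈ ball x (t x / 2) := by
        have : y ∈ closedBall x (4 * (t x / 16)) :=
          hxsub (mem_closedBall_self (by have := ht0 y hyP; positivity))
        rw [mem_closedBall] at this
        rw [mem_ball]
        linarith
      have hyx' : y ∈ ball x (t x) := ball_subset_ball (by linarith) hyx
      refine mem_iUnion₂.2 ⟨x, hxU, ?_⟩
      by_contra hcon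
      rw [mem_union, not_or] at hcon
      have h1 : ε ≤ ψ (σ x) y := by
        by_contra! h
        exact hcon.2 ⟨hyx', h⟩
      have h2 := hcon.1
      simp only [Bad, mem_ofPred_eq, not_and, not_not] at h2
      obtain ⟨F, hF, hFc, hFρ, hFε⟩ := h2 hyx'
      refine hun ⟨insert (σ x) F, ?_, ?_, ?_, ?_⟩
      · intro s hs
        rcases Finset.mem_insert.1 hs with rfl | hs
        · exact hσS x hxP
        · exact (hF s hs).1
      · intro s hs u hu
        rcases Finset.mem_insert.1 hs with rfl | hs <;>
          rcases Finset.mem_insert.1 hu with rfl | hu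
        · exact hrefl _
        · exact hsymm _ _ (hF u hu).2.2
        · exact (hF s hs).2.2
        · exact hFc s hs u hu
      · intro s hs
        rcases Finset.mem_insert.1 hs with rfl | hs
        · exact hσ x hxP y hyx
        · exact hFρ s hs
      · intro s hs hsc
        by_cases hsσ : s = σ x
        · rw [hsσ]; exact h1
        · exact hFε s ⟨hs, hsσ, hsc _ (Finset.mem_insert_self _ _)⟩ fun u hu =>
            hsc u (Finset.mem_insert_of_mem hu)
    have hvol : ∀ x ∈ P, volume (ball x (t x)) = 16 ^ d * volume (ball x (t x / 16)) := by
      intro x hx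
      have htx := ht0 x hx
      rw [Real.volume_pi_ball _ htx, Real.volume_pi_ball _ (by positivity)]
      rw [show (16 : ENNReal) = ENNReal.ofReal 16 by simp, ← ENNReal.ofReal_pow (by norm_num),
        ← ENNReal.ofReal_mul (by positivity), Fintype.card_fin, ← mul_pow]
      congr 2
      ring
    have hvol3 : volume (ball z (3 * r)) = 3 ^ d * volume (ball z r) := by
      rw [Real.volume_pi_ball _ hr, Real.volume_pi_ball _ (by positivity)]
      rw [show (3 : ENNReal) = ENNReal.ofReal 3 by simp, ← ENNReal.ofReal_pow (by norm_num),
        ← ENNReal.ofReal_mul (by positivity), Fintype.card_fin, ← mul_pow]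
      congr 2
      ring
    have hdisj : ∑' x : U, volume (ball (x : Fin d → ℝ) (t x / 16)) ≤ volume (ball z (3 * r)) := by
      have := hUc.to_subtype
      rw [← measure_iUnion]
      · refine measure_mono (iUnion_subset fun x => ball_subset_ball' ?_)
        have h1 := (hUP x.2).1
        have h2 := ht2 x (hUP x.2)
        rw [mem_ball] at h1
        linarith
      · intro x y hxy
        exact (hUd x.2 y.2 (fun h => hxy (Subtype.ext h))).mono ball_subset_closedBall
          ball_subset_closedBall
      · exact fun _ => measurableSet_ball
    set K : ENNReal := (2 * 48 ^ d) ^ k with hK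
    have hK1 : 1 ≤ K := one_le_pow₀ (by
      calc (1 : ENNReal) ≤ 2 * 1 := by norm_num
        _ ≤ 2 * 48 ^ d := by gcongr; exact one_le_pow₀ (by norm_num))
    calc _ ≤ volume (⋃ x ∈ U, Bad x ∪ Low x) := measure_mono hcover
      _ ≤ ∑' x : U, volume (Bad x ∪ Low x) := measure_biUnion_le _ hUc _
      _ ≤ ∑' x : U, (2 * K * κ * 16 ^ d) * volume (ball (x : Fin d → ℝ) (t x / 16)) := by
        refine ENNReal.tsum_le_tsum fun x => ?_
        have hx := hUP x.2
        calc _ ≤ volume (Bad x) + volume (Low x) := measure_union_le _ _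
          _ ≤ K * κ * volume (ball (x : Fin d → ℝ) (t x)) +
              1 * κ * volume (ball (x : Fin d → ℝ) (t x)) := by
            rw [one_mul]; exact add_le_add (hBad x hx) (hLow x hx)
          _ ≤ K * κ * volume (ball (x : Fin d → ℝ) (t x)) +
              K * κ * volume (ball (x : Fin d → ℝ) (t x)) := by gcongr
          _ = _ := by rw [hvol x hx]; ring
      _ = (2 * K * κ * 16 ^ d) * ∑' x : U, volume (ball (x : Fin d → ℝ) (t x / 16)) :=
        ENNReal.tsum_mul_left
      _ ≤ (2 * K * κ * 16 ^ d) * volume (ball z (3 * r)) := by gcongr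
      _ = _ := by
        rw [hvol3, pow_succ, ← hK, show (48 : ENNReal) = 16 * 3 by norm_num, mul_pow]
        ring

/-- The inclusion `ℤ^k → ℚ^k`. -/
def intToRat (k : ℕ) : (Fin k → ℤ) →ₗ[ℤ] (Fin k → ℚ) where
  toFun u i := u i
  map_add' u v := by ext; simp
  map_smul' m u := by ext; simp

@[simp] lemma intToRat_apply {k : ℕ} (u : Fin k → ℤ) (i : Fin k) : intToRat k u i = u i := rfl

lemma intToRat_injective (k : ℕ) : Function.Injective (intToRat k) := fun u v h => by
  ext i
  have := congrFun h i
  simpa using this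

lemma linearIndependent_intToRat_iff {k : ℕ} {ι : Type*} (v : ι → Fin k → ℤ) :
    LinearIndependent ℚ (intToRat k ∘ v) ↔ LinearIndependent ℤ v := by
  rw [← LinearIndependent.iff_fractionRing ℤ ℚ]
  exact LinearMap.linearIndependent_iff _ (LinearMap.ker_eq_bot.2 (intToRat_injective k))

lemma exists_smul_eq_intToRat {k : ℕ} (v : Fin k → ℚ) :
    ∃ m : ℤ, m ≠ 0 ∧ ∃ u, intToRat k u = m • v := by
  obtain ⟨m, hm⟩ := IsLocalization.exist_integer_multiples_of_finite (nonZeroDivisors ℤ) v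
  choose u hu using hm
  refine ⟨m, nonZeroDivisors.coe_ne_zero m, u, ?_⟩
  ext i
  simpa using hu i

/-- The lattice of integer points of a rational subspace has a basis of the expected size. -/
lemma exists_int_basis {k : ℕ} (V : Submodule ℚ (Fin k → ℚ)) :
    ∃ b : Fin (Module.finrank ℚ V) → Fin k → ℤ, LinearIndependent ℤ b ∧
      (∀ a, intToRat k (b a) ∈ V) ∧
      ∀ u, intToRat k u ∈ V → u ∈ Submodule.span ℤ (Set.range b) := by
  let L : Submodule ℤ (Fin k → ℤ) := (V.restrictScalars ℤ).comap (intToRat k)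
  let b₀ := Module.finBasis ℤ L
  let b : Fin (Module.finrank ℤ L) → Fin k → ℤ := fun a => (b₀ a : Fin k → ℤ)
  have hbV : ∀ a, intToRat k (b a) ∈ V := fun a => (b₀ a).2
  have hbli : LinearIndependent ℤ b :=
    b₀.linearIndependent.map' L.subtype L.ker_subtype
  have hspan : ∀ u, intToRat k u ∈ V → u ∈ Submodule.span ℤ (Set.range b) := by
    intro u hu
    have h1 : (⟨u, hu⟩ : L) ∈ Submodule.span ℤ (Set.range b₀) := by
      rw [b₀.span_eq]; trivial
    have h2 := Submodule.mem_map_of_mem (f := L.subtype) h1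
    rw [Submodule.map_span, ← Set.range_comp] at h2
    exact h2
  have hQ := (linearIndependent_intToRat_iff b).2 hbli
  have hV : Submodule.span ℚ (Set.range (intToRat k ∘ b)) = V := by
    refine le_antisymm (Submodule.span_le.2 (by rintro _ ⟨a, rfl⟩; exact hbV a)) fun v hv => ?_
    obtain ⟨m, hm, u, hu⟩ := exists_smul_eq_intToRat v
    have huV : intToRat k u ∈ V := by
      rw [hu]; exact V.smul_of_tower_mem m hv
    have h2 := Submodule.mem_map_of_mem (f := intToRat k) (hspan u huV)
    rw [Submodule.map_span, ← Set.range_comp] at h2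
    have h3 := Submodule.span_le_restrictScalars ℤ ℚ _ h2
    rw [Submodule.restrictScalars_mem, hu] at h3
    have hmQ : (m : ℚ) ≠ 0 := by exact_mod_cast hm
    have h4 := Submodule.smul_mem _ (m : ℚ)⁻¹ h3
    rwa [← Int.cast_smul_eq_zsmul ℚ, smul_smul, inv_mul_cancel₀ hmQ, one_smul] at h4
  have hrank : Module.finrank ℤ L = Module.finrank ℚ V := by
    have := finrank_span_eq_card hQ
    rw [hV, Fintype.card_fin] at this
    exact this.symm
  rw [← hrank]
  exact ⟨b, hbli, hbV, hspan⟩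

/-- A `ℤ`-basis of the integer points of a rational subspace. -/
noncomputable def intBasis {k : ℕ} (V : Submodule ℚ (Fin k → ℚ)) :
    Fin (Module.finrank ℚ V) → Fin k → ℤ :=
  (exists_int_basis V).choose

lemma linearIndependent_intBasis {k : ℕ} (V : Submodule ℚ (Fin k → ℚ)) :
    LinearIndependent ℤ (intBasis V) :=
  (exists_int_basis V).choose_spec.1

lemma intToRat_intBasis_mem {k : ℕ} (V : Submodule ℚ (Fin k → ℚ)) (a) :
    intToRat k (intBasis V a) ∈ V :=
  (exists_int_basis V).choose_spec.2.1 a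

lemma mem_span_intBasis {k : ℕ} (V : Submodule ℚ (Fin k → ℚ)) {u : Fin k → ℤ}
    (hu : intToRat k u ∈ V) : u ∈ Submodule.span ℤ (Set.range (intBasis V)) :=
  (exists_int_basis V).choose_spec.2.2 u hu

/-- If `g` is marked by a flag `F`, then `g ℤ^k` has no short nonzero vector. -/
lemma le_mul_of_marked {k : ℕ} (g : Matrix (Fin k) (Fin k) ℝ) (hg : g.det = 1) {ρ ε : ℝ}
    (hρ : ρ ≤ 1) (hερ : ε ≤ ρ) (F : Finset (Submodule ℚ (Fin k → ℚ)))
    (hcomp : ∀ V ∈ F, ∀ W ∈ F, V ≤ W ∨ W ≤ V)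
    (hF : ∀ V ∈ F, wedgeNorm g (intBasis V) < ρ)
    (hmark : ∀ V, V ≠ ⊥ → V ≠ ⊤ → (∀ W ∈ F, V ≤ W ∨ W ≤ V) → ε ≤ wedgeNorm g (intBasis V))
    {u : Fin k → ℤ} (hu : u ≠ 0) {η : ℝ} (hη0 : 0 ≤ η)
    (hη : ∀ i, |g.mulVec (fun i => (u i : ℝ)) i| ≤ η) : ε ≤ k * η := by
  classical
  obtain ⟨W, hW⟩ := Finset.exists_maximal
    (s := (insert ⊥ F).filter fun V => intToRat k u ∉ V) ⟨⊥, by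
      simp only [Finset.mem_filter, Finset.mem_insert_self, true_and, Submodule.mem_bot]
      exact fun h => hu (intToRat_injective k (by rw [h, map_zero]))⟩
  have hWmem := Finset.mem_filter.1 hW.prop
  have huW := hWmem.2
  have hWcomp : ∀ V ∈ F, V ≤ W ∨ W ≤ V := by
    intro V hV
    rcases Finset.mem_insert.1 hWmem.1 with h | h
    · exact Or.inr (h ▸ bot_le)
    · exact hcomp V hV W h
  have hW1 : wedgeNorm g (intBasis W) ≤ 1 := by
    rcases Finset.mem_insert.1 hWmem.1 with h | h
    · exact wedgeNorm_le_one_of_eq_zero (by rw [h]; simp) _ _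
    · exact (hF W h).le.trans hρ
  set V' := W ⊔ Submodule.span ℚ {intToRat k u} with hV'
  have huV' : intToRat k u ∈ V' := by
    exact Submodule.mem_sup_right (Submodule.mem_span_singleton_self _)
  have hrank : Module.finrank ℚ V' = Module.finrank ℚ W + 1 := by
    exact Submodule.finrank_sup_span_singleton huW
  have hle1 : wedgeNorm g (intBasis V') ≤
      wedgeNorm g (Fin.cons u (intBasis W) : Fin (Module.finrank ℚ W + 1) → Fin k → ℤ) := by
    refine wedgeNorm_le_of_mem_span hrank g _ _ ?_ fun a => ?_
    · rw [← linearIndependent_intToRat_iff]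
      have : intToRat k ∘ (Fin.cons u (intBasis W) : Fin (Module.finrank ℚ W + 1) → Fin k → ℤ) =
          Fin.cons (intToRat k u) (intToRat k ∘ intBasis W) := by
        ext a : 1
        refine Fin.cases rfl (fun i => rfl) a
      rw [this, linearIndependent_finCons]
      refine ⟨(linearIndependent_intToRat_iff _).2 (linearIndependent_intBasis W), fun h => huW ?_⟩
      refine Submodule.span_le.2 ?_ h
      rintro _ ⟨a, rfl⟩
      exact intToRat_intBasis_mem W a
    · refine mem_span_intBasis V' ?_
      refine Fin.cases huV' (fun i => ?_) a
      exact Submodule.mem_sup_left (intToRat_intBasis_mem W i)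
  have hrk : (Module.finrank ℚ W : ℝ) + 1 ≤ k := by
    have := V'.finrank_le
    rw [hrank, Module.finrank_fin_fun] at this
    exact_mod_cast this
  have hle : wedgeNorm g (intBasis V') ≤ k * η := by
    refine hle1.trans ((wedgeNorm_cons_le g (intBasis W) u hη hη0).trans ?_)
    exact mul_le_mul hrk (mul_le_of_le_one_right hη0 hW1)
      (mul_nonneg hη0 ((abs_nonneg _).trans (abs_le_multiNorm _ ∅))) (by positivity)
  refine le_trans ?_ hle
  by_cases htop : V' = ⊤
  · refine (hερ.trans hρ).trans (one_le_wedgeNorm_of_det_eq_one ?_ g hg _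
      (linearIndependent_intBasis V'))
    rw [htop, finrank_top, Module.finrank_fin_fun]
  · refine hmark V' ?_ htop fun V hV => ?_
    · intro h
      rw [h, finrank_bot] at hrank
      omega
    · by_cases huV : intToRat k u ∈ V
      · refine Or.inl (sup_le ?_ ((Submodule.span_singleton_le_iff_mem _ _).2 huV))
        rcases hWcomp V hV with h | h
        · exact absurd (h huV) huW
        · exact h
      · refine Or.inr (le_trans ?_ le_sup_left)
        rcases hWcomp V hV with h | h
        · exact h
        · exact hW.le_of_ge (Finset.mem_filter.2 ⟨Finset.mem_insert_of_mem hV, huV⟩) h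

/-- A chain of proper nonzero subspaces of `ℚ^{n+1}` has at most `n` elements. -/
lemma card_le_of_chain {n : ℕ} (F : Finset (Submodule ℚ (Fin (n + 1) → ℚ)))
    (hF : ∀ V ∈ F, V ≠ ⊥ ∧ V ≠ ⊤) (hcomp : ∀ V ∈ F, ∀ W ∈ F, V ≤ W ∨ W ≤ V) :
    F.card ≤ n := by
  have hinj : Set.InjOn (fun V : Submodule ℚ (Fin (n + 1) → ℚ) => Module.finrank ℚ V) F := by
    intro V hV W hW h
    rcases hcomp V hV W hW with hVW | hVW
    · exact Submodule.eq_of_le_of_finrank_eq hVW h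
    · exact (Submodule.eq_of_le_of_finrank_eq hVW h.symm).symm
  calc F.card ≤ (Finset.Icc 1 n).card := by
        refine Finset.card_le_card_of_injOn _ (fun V hV => ?_) hinj
        obtain ⟨h1, h2⟩ := hF V hV
        have h3 := Submodule.finrank_lt h2
        rw [Module.finrank_fin_fun] at h3
        have h4 : Module.finrank ℚ V ≠ 0 := fun h => h1 (Submodule.finrank_eq_zero.1 h)
        simp only [Finset.coe_Icc, Set.mem_Icc]
        omega
    _ = n := by simp

lemma det_gMat_mul_uMat {n : ℕ} (hn : n ≠ 0) (t : ℝ) (y : Fin n → ℝ) :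
    (gMat n t * uMat y).det = 1 := by
  have hu : (uMat y).det = 1 := by
    rw [Matrix.det_of_isUpperTriangular]
    · rw [Fin.prod_univ_succ]
      simp [uMat]
    · intro i j hij
      refine Fin.cases (fun h => ?_) (fun i h => ?_) i hij
      · simp at h
      · revert h
        refine Fin.cases (fun _ => ?_) (fun j h => ?_) j
        · simp [uMat]
        · have : i ≠ j := by
            rintro rfl
            simp at h
          simp [uMat, this]
  have hn' : (n : ℝ) ≠ 0 := by exact_mod_cast hn
  rw [Matrix.det_mul, hu, mul_one, gMat, Matrix.det_diagonal, Fin.prod_univ_succ]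
  simp only [Fin.cons_zero, Fin.cons_succ, Finset.prod_const, Finset.card_univ, Fintype.card_fin]
  rw [← Real.exp_nat_mul, ← Real.exp_add]
  simp [mul_div_cancel₀ _ hn']

lemma gMat_mul_uMat_mulVec_zero {n : ℕ} (t : ℝ) (y : Fin n → ℝ) (w : Fin (n + 1) → ℝ) :
    (gMat n t * uMat y).mulVec w 0 = Real.exp t * (w 0 + ∑ i : Fin n, y i * w i.succ) := by
  rw [← Matrix.mulVec_mulVec, gMat, Matrix.mulVec_diagonal]
  simp [uMat, Matrix.mulVec, dotProduct, Fin.sum_univ_succ]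

lemma gMat_mul_uMat_mulVec_succ {n : ℕ} (t : ℝ) (y : Fin n → ℝ) (w : Fin (n + 1) → ℝ)
    (i : Fin n) :
    (gMat n t * uMat y).mulVec w i.succ = Real.exp (-t / n) * w i.succ := by
  rw [← Matrix.mulVec_mulVec, gMat, Matrix.mulVec_diagonal]
  simp [uMat, Matrix.mulVec, dotProduct, Fin.sum_univ_succ]

/-- The coordinates of `g_t u_y w` are affine functions of `y`. -/
lemma exists_extAction_eq_affine {n : ℕ} (t : ℝ) (w : Finset (Fin (n + 1)) → ℝ)
    (I : Finset (Fin (n + 1))) :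
    ∃ (c₀ : ℝ) (c : Fin n → ℝ), ∀ y : Fin n → ℝ,
      extAction (gMat n t * uMat y) w I = c₀ + ∑ i, c i * y i := by
  have hdet : ∀ (m : ℕ) (p q : Fin m → Fin (n + 1)), StrictMono p →
      ∃ (c₀ : ℝ) (c : Fin n → ℝ), ∀ y : Fin n → ℝ,
        (Matrix.of fun a b => (gMat n t * uMat y) (p a) (q b)).det = c₀ + ∑ i, c i * y i := by
    intro m p q hp
    have hent0 : ∀ j : Fin (n + 1), ∀ y : Fin n → ℝ,
        (gMat n t * uMat y) 0 j = Real.exp t * (Fin.cons 1 y : Fin (n + 1) → ℝ) j := by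
      intro j y
      simp [gMat, uMat]
    have hent : ∀ (i : Fin n) (j : Fin (n + 1)) (y : Fin n → ℝ),
        (gMat n t * uMat y) i.succ j = (gMat n t * uMat (0 : Fin n → ℝ)) i.succ j := by
      intro i j y
      simp [gMat, uMat]
    by_cases h0 : ∃ a, p a = 0
    · obtain ⟨a₀, ha₀⟩ := h0
      have hne : ∀ a, a ≠ a₀ → ∃ i : Fin n, p a = i.succ := fun a ha =>
        ⟨(p a).pred fun h => ha (hp.injective (h.trans ha₀.symm)), by simp⟩
      let M : Fin m → Fin m → ℝ := fun a b => (gMat n t * uMat (0 : Fin n → ℝ)) (p a) (q b)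
      let φ : (Fin m → ℝ) →ₗ[ℝ] ℝ :=
        (Matrix.detRowAlternating (n := Fin m) (R := ℝ)).toMultilinearMap.toLinearMap M a₀
      let r : Fin (n + 1) → Fin m → ℝ := fun j b => if q b = j then Real.exp t else 0
      have hφ : ∀ y : Fin n → ℝ, (Matrix.of fun a b => (gMat n t * uMat y) (p a) (q b)).det =
          φ (∑ j, (Fin.cons 1 y : Fin (n + 1) → ℝ) j • r j) := by
        intro y
        change _ = Matrix.det (Matrix.of (Function.update M a₀ _))
        congr 1
        ext a b
        rw [Matrix.of_apply, Matrix.of_apply]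
        by_cases ha : a = a₀
        · subst ha
          rw [Function.update_self, ha₀, hent0]
          simp [r, Finset.sum_apply, mul_comm]
        · obtain ⟨i, hi⟩ := hne a ha
          rw [Function.update_of_ne ha, hi, hent]
          simp only [M, hi]
      refine ⟨φ (r 0), fun i => φ (r i.succ), fun y => ?_⟩
      rw [hφ, map_sum, Fin.sum_univ_succ]
      simp [mul_comm]
    · push Not at h0
      refine ⟨(Matrix.of fun a b => (gMat n t * uMat (0 : Fin n → ℝ)) (p a) (q b)).det, 0, fun y => ?_⟩
      simp only [Pi.zero_apply, zero_mul, Finset.sum_const_zero, add_zero]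
      congr 1
      ext a b
      simp only [Matrix.of_apply]
      rw [← Fin.succ_pred (p a) (h0 a)]
      exact hent _ _ _
  have hJ : ∀ J : Finset (Fin (n + 1)), ∃ (c₀ : ℝ) (c : Fin n → ℝ), ∀ y : Fin n → ℝ,
      (if hJ : J.card = I.card then
        (Matrix.det (Matrix.of fun a b : Fin I.card =>
          (gMat n t * uMat y) ((I.orderIsoOfFin rfl) a : Fin (n + 1))
            ((J.orderIsoOfFin hJ) b : Fin (n + 1)))) * w J
      else 0) = c₀ + ∑ i, c i * y i := by
    intro J
    split_ifs with h
    · obtain ⟨c₀, c, hc⟩ := hdet I.card (fun a => I.orderIsoOfFin rfl a)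
        (fun b => J.orderIsoOfFin h b) (I.orderEmbOfFin rfl).strictMono
      refine ⟨c₀ * w J, fun i => c i * w J, fun y => ?_⟩
      rw [hc, add_mul, Finset.sum_mul]
      congr 1
      exact Finset.sum_congr rfl fun i _ => by ring
    · exact ⟨0, 0, by simp⟩
  choose c₀ c hc using hJ
  refine ⟨∑ J, c₀ J, fun i => ∑ J, c J i, fun y => ?_⟩
  unfold extAction
  simp_rw [hc, Finset.sum_add_distrib, Finset.sum_mul]
  rw [Finset.sum_comm]

/-- Dani correspondence: for a very well approximable vector `y`, the lattices
`g_t u_y ℤ^{n+1}` have exponentially short nonzero vectors along an unbounded set of times `t`. -/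
lemma IsVWA.exists_short_vector {n : ℕ} (hn : n ≠ 0) {y : Fin n → ℝ} (hy : IsVWA y) :
    ∃ m : ℕ, ∀ T : ℕ, ∃ t : ℕ, T ≤ t ∧ ∃ u : Fin (n + 1) → ℤ, u ≠ 0 ∧
      ∀ i, |(gMat n t * uMat y).mulVec (fun i => (u i : ℝ)) i| ≤
        Real.exp (-(1 / ((m : ℝ) + 1)) * t) := by
  obtain ⟨v, hv, hinf⟩ := hy
  have hn0 : (0 : ℝ) < n := by exact_mod_cast Nat.pos_of_ne_zero hn
  set a : ℝ := (n + v) / 2 with ha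
  have han : (n : ℝ) < a := by rw [ha]; linarith
  have hav : a < v := by rw [ha]; linarith
  have ha0 : 0 < a := hn0.trans han
  have hδ : 0 < min (min 1 ((v - a) / (2 * a))) ((a / n - 1) / a) := by
    refine lt_min (lt_min one_pos (div_pos (by linarith) (by linarith))) (div_pos ?_ ha0)
    rw [sub_pos, one_lt_div hn0]
    exact han
  obtain ⟨m, hm⟩ := exists_nat_one_div_lt hδ
  refine ⟨m, fun T => ?_⟩
  set γ : ℝ := 1 / ((m : ℝ) + 1) with hγ
  have hγ0 : 0 < γ := by positivity
  have hγ1 : γ ≤ 1 := hm.le.trans ((min_le_left _ _).trans (min_le_left _ _))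
  have hγ2 : γ * (2 * a) ≤ v - a := by
    rw [← le_div_iff₀ (by positivity)]
    exact hm.le.trans ((min_le_left _ _).trans (min_le_right _ _))
  have hγ3 : γ * a ≤ a / n - 1 := by
    rw [← le_div_iff₀ (by positivity)]
    exact hm.le.trans (min_le_right _ _)
  obtain ⟨q, ⟨p, hp⟩, hq⟩ : ∃ q : Fin n → ℤ, (∃ p : ℤ,
      |(∑ i, y i * (q i : ℝ)) + (p : ℝ)| ≤ ‖(fun i => (q i : ℝ) : Fin n → ℝ)‖ ^ (-v)) ∧
      Real.exp (4 / (v - a) + T / a) < ‖(fun i => (q i : ℝ) : Fin n → ℝ)‖ := by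
    by_contra! hcon
    refine hinf ((Set.finite_Icc
      (fun _ : Fin n => -⌈Real.exp (4 / (v - a) + T / a)⌉)
      (fun _ : Fin n => ⌈Real.exp (4 / (v - a) + T / a)⌉)).subset fun q hq => ?_)
    have h := hcon q hq
    have h1 : ∀ i, |(q i : ℝ)| ≤ ⌈Real.exp (4 / (v - a) + T / a)⌉ := fun i =>
      ((norm_le_pi_norm (fun i => (q i : ℝ) : Fin n → ℝ) i).trans h).trans (Int.le_ceil _)
    have h2 : ∀ i, |q i| ≤ ⌈Real.exp (4 / (v - a) + T / a)⌉ := fun i => by exact_mod_cast h1 i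
    exact ⟨fun i => (abs_le.1 (h2 i)).1, fun i => (abs_le.1 (h2 i)).2⟩
  set N := ‖(fun i => (q i : ℝ) : Fin n → ℝ)‖ with hN
  have hN0 : 0 < N := (Real.exp_pos _).trans hq
  set l := Real.log N with hl
  have hexpl : Real.exp l = N := Real.exp_log hN0
  have hlb : 4 / (v - a) + T / a < l := by rwa [← hexpl, Real.exp_lt_exp] at hq
  have hva : 0 < v - a := by linarith
  have hl1 : 4 ≤ l * (v - a) := by
    rw [← div_le_iff₀ hva]
    have : (0 : ℝ) ≤ T / a := by positivity
    linarith
  have hl2 : (T : ℝ) ≤ a * l := by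
    rw [mul_comm, ← div_le_iff₀ ha0]
    have : (0 : ℝ) ≤ 4 / (v - a) := by positivity
    linarith
  have hl0 : 0 < l := by
    by_contra! h
    nlinarith
  have ht1 : a * l ≤ ⌈a * l⌉₊ := Nat.le_ceil _
  have ht2 : (⌈a * l⌉₊ : ℝ) < a * l + 1 := Nat.ceil_lt_add_one (by positivity)
  set t := ⌈a * l⌉₊ with ht
  refine ⟨t, by exact_mod_cast hl2.trans ht1, Fin.cons p q, ?_, ?_⟩
  · intro h0
    have hq0 : q = 0 := by
      ext i
      simpa using congrFun h0 i.succ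
    rw [hN, hq0] at hN0
    simp only [Pi.zero_apply, Int.cast_zero] at hN0
    exact absurd hN0 (by simp [← Pi.zero_def])
  · intro i
    refine Fin.cases ?_ (fun i => ?_) i
    · rw [gMat_mul_uMat_mulVec_zero, abs_mul, Real.abs_exp]
      simp only [Fin.cons_zero, Fin.cons_succ]
      rw [add_comm (p : ℝ)]
      refine (mul_le_mul_of_nonneg_left hp (Real.exp_pos _).le).trans ?_
      rw [Real.rpow_def_of_pos hN0, ← Real.exp_add, Real.exp_le_exp, ← hl]
      nlinarith [mul_le_mul_of_nonneg_left hγ2 hl0.le, mul_le_mul_of_nonneg_left ht2.le hγ0.le]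
    · rw [gMat_mul_uMat_mulVec_succ, abs_mul, Real.abs_exp]
      simp only [Fin.cons_succ]
      have : |(q i : ℝ)| ≤ Real.exp l := by
        rw [hexpl]
        exact norm_le_pi_norm (fun i => (q i : ℝ) : Fin n → ℝ) i
      refine (mul_le_mul_of_nonneg_left this (Real.exp_pos _).le).trans ?_
      rw [← Real.exp_add, Real.exp_le_exp]
      have h1 : 1 ≤ a * (1 / n - γ) := by
        have : a * (1 / n - γ) = a / n - γ * a := by ring
        linarith
      have h2 : 0 ≤ 1 / n - γ := by
        by_contra! h
        nlinarith
      have h3 := mul_le_mul_of_nonneg_right ht1 h2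
      have h4 : l ≤ a * l * (1 / n - γ) := by nlinarith
      have h5 : (-(t : ℝ) / n) = -(t * (1 / n)) := by ring
      rw [h5]
      nlinarith

/-- Quantitative nondivergence: the set of points of a ball whose lattice `g_t u_{f(x)} ℤ^{n+1}`
has a short nonzero vector is small. -/
lemma volume_short_vector_le {d n : ℕ} (hn : n ≠ 0) (x₀ : Fin d → ℝ) {r : ℝ} (hr : 0 < r)
    (f : (Fin d → ℝ) → Fin n → ℝ)
    (hcont : ContinuousOn f (Metric.ball x₀ ((3 : ℝ) ^ (n + 1) * r)))
    {C α : ℝ}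
    (hgood : ∀ (c₀ : ℝ) (c : Fin n → ℝ),
      IsGoodOn C α (fun x => c₀ + ∑ i, c i * f x i)
        (Metric.ball x₀ ((3 : ℝ) ^ (n + 1) * r)))
    (t : ℝ) {ρ ε η : ℝ} (hρ : ρ ≤ 1) (hε : 0 < ε) (hερ : ε ≤ ρ)
    (hsup : ∀ j : ℕ, 1 ≤ j → j ≤ n → ∀ w : Finset (Fin (n + 1)) → ℝ, IsPrim j w →
      ρ < sSup ((fun x => multiNorm (extAction (gMat n t * uMat (f x)) w)) '' Metric.ball x₀ r))
    (hη : 0 ≤ η) (hηε : ((n + 1 : ℕ) : ℝ) * η < ε) :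
    volume {x ∈ Metric.ball x₀ r | ∃ u : Fin (n + 1) → ℤ, u ≠ 0 ∧
      ∀ i, |(gMat n t * uMat (f x)).mulVec (fun i => (u i : ℝ)) i| ≤ η} ≤
      (2 * 48 ^ d) ^ n * ENNReal.ofReal (C * (ε / ρ) ^ α) * volume (Metric.ball x₀ r) := by
  have hρ0 : 0 < ρ := hε.trans_le hερ
  have hsub : Metric.closedBall x₀ (3 ^ n * r) ⊆ Metric.ball x₀ (3 ^ (n + 1) * r) := by
    refine Metric.closedBall_subset_ball ?_
    rw [pow_succ]
    have : 0 < (3 : ℝ) ^ n * r := by positivity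
    linarith
  have hcoord : ∀ (c₀ : ℝ) (c : Fin n → ℝ),
      ContinuousOn (fun x => c₀ + ∑ i, c i * f x i) (Metric.ball x₀ (3 ^ (n + 1) * r)) :=
    fun c₀ c => by fun_prop
  refine (measure_mono ?_).trans (volume_unmarked_le
    (fun V W : Submodule ℚ (Fin (n + 1) → ℚ) => V ≤ W ∨ W ≤ V) (fun V => Or.inl le_rfl)
    (fun V W h => h.symm) hερ (ENNReal.ofReal (C * (ε / ρ) ^ α))
    (fun V x => wedgeNorm (gMat n t * uMat (f x)) (intBasis V)) n {V | V ≠ ⊥ ∧ V ≠ ⊤}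
    (fun F hF hcomp => card_le_of_chain F hF hcomp) x₀ r hr ?_ ?_ ?_)
  · rintro x ⟨hx, u, hu, hshort⟩
    refine ⟨hx, ?_⟩
    rintro ⟨F, -, hcomp, hF, hmark⟩
    have := le_mul_of_marked (gMat n t * uMat (f x)) (det_gMat_mul_uMat hn t (f x)) hρ hερ F
      hcomp hF (fun V h1 h2 h3 => hmark V ⟨h1, h2⟩ h3) hu hη hshort
    linarith
  · rintro V - x - s hs hxs ⟨y, hy, hρy⟩
    obtain ⟨I, hI⟩ := exists_multiNorm_eq
      (extAction (gMat n t * uMat (f y)) fun J => (minorDet (intBasis V) J : ℝ))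
    obtain ⟨c₀, c, hc⟩ := exists_extAction_eq_affine t (fun J => (minorDet (intBasis V) J : ℝ)) I
    have hbdd : BddAbove ((fun x => |c₀ + ∑ i, c i * f x i|) '' Metric.ball x s) :=
      (((isCompact_closedBall x₀ (3 ^ n * r)).image_of_continuousOn
        ((hcoord c₀ c).mono hsub).abs).bddAbove).mono
        (Set.image_mono (hxs.trans Metric.ball_subset_closedBall))
    have hle : ρ ≤ sSup ((fun x => |c₀ + ∑ i, c i * f x i|) '' Metric.ball x s) := by
      refine le_trans ?_ (le_csSup hbdd ⟨y, hy, rfl⟩)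
      change ρ ≤ |c₀ + ∑ i, c i * f y i|
      rw [← hc, hI]
      exact hρy
    refine (measure_mono ?_).trans (hgood c₀ c x s hs
      ((hxs.trans Metric.ball_subset_closedBall).trans hsub) (ε / ρ) (div_pos hε hρ0))
    rintro z ⟨hz, hzε⟩
    refine ⟨hz, ?_⟩
    change |c₀ + ∑ i, c i * f z i| < _
    rw [← hc]
    calc _ ≤ wedgeNorm (gMat n t * uMat (f z)) (intBasis V) := abs_le_multiNorm _ I
      _ < ε := hzε
      _ = ε / ρ * ρ := (div_mul_cancel₀ ε hρ0.ne').symm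
      _ ≤ _ := mul_le_mul_of_nonneg_left hle (div_pos hε hρ0).le
  · rintro V - x hx hxρ
    have h : ∀ᶠ y in nhds x, ∀ I,
        |extAction (gMat n t * uMat (f y)) (fun J => (minorDet (intBasis V) J : ℝ)) I| < ρ := by
      refine Filter.eventually_all.2 fun I => ?_
      obtain ⟨c₀, c, hc⟩ := exists_extAction_eq_affine t
        (fun J => (minorDet (intBasis V) J : ℝ)) I
      simp only [hc]
      refine (((hcoord c₀ c).continuousAt (Metric.isOpen_ball.mem_nhds
        (hsub (Metric.ball_subset_closedBall hx)))).abs).eventually_lt_const ?_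
      change |c₀ + ∑ i, c i * f x i| < ρ
      rw [← hc]
      exact (abs_le_multiNorm _ I).trans_lt hxρ
    filter_upwards [h] with y hy
    obtain ⟨I, hI⟩ := exists_multiNorm_eq
      (extAction (gMat n t * uMat (f y)) fun J => (minorDet (intBasis V) J : ℝ))
    exact hI.symm.trans_lt (hy I)
  · rintro V ⟨hbot, htop⟩
    have h1 : 1 ≤ Module.finrank ℚ V :=
      Nat.one_le_iff_ne_zero.2 fun h => hbot (Submodule.finrank_eq_zero.1 h)
    have h2 := Submodule.finrank_lt htop
    rw [Module.finrank_fin_fun] at h2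
    obtain ⟨_, ⟨y, hy, rfl⟩, hlt⟩ := exists_lt_of_lt_csSup
      ((Metric.nonempty_ball.2 hr).image _)
      (hsup _ h1 (Nat.lt_succ_iff.1 h2) (fun J => (minorDet (intBasis V) J : ℝ))
        ⟨intBasis V, linearIndependent_intBasis V, fun _ => rfl⟩)
    exact ⟨y, hy, hlt.le⟩

open Filter Topology in
/-- Almost every trajectory has only finitely many exponentially short vectors. -/
lemma volume_frequently_short_vector {d n : ℕ} (hn : n ≠ 0) (x₀ : Fin d → ℝ) {r : ℝ} (hr : 0 < r)
    (f : (Fin d → ℝ) → Fin n → ℝ)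
    (hcont : ContinuousOn f (Metric.ball x₀ ((3 : ℝ) ^ (n + 1) * r)))
    {C α : ℝ} (hα : 0 < α)
    (hgood : ∀ (c₀ : ℝ) (c : Fin n → ℝ),
      IsGoodOn C α (fun x => c₀ + ∑ i, c i * f x i)
        (Metric.ball x₀ ((3 : ℝ) ^ (n + 1) * r)))
    (h36 : Cond36ii (Metric.ball x₀ r) f) {γ : ℝ} (hγ : 0 < γ) :
    volume {x ∈ Metric.ball x₀ r | ∀ T : ℕ, ∃ t : ℕ, T ≤ t ∧ ∃ u : Fin (n + 1) → ℤ, u ≠ 0 ∧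
      ∀ i, |(gMat n t * uMat (f x)).mulVec (fun i => (u i : ℝ)) i| ≤ Real.exp (-γ * t)} = 0 := by
  obtain ⟨T, -, hT⟩ := h36 (γ / 2) (half_pos hγ)
  have hlim : Tendsto (fun t : ℕ => 4 * ((n : ℝ) + 1) * Real.exp (-(γ / 2) * t)) atTop (𝓝 0) := by
    rw [← mul_zero (4 * ((n : ℝ) + 1))]
    refine Tendsto.const_mul _ (Real.tendsto_exp_atBot.comp ?_)
    exact tendsto_natCast_atTop_atTop.const_mul_atTop_of_neg (by linarith)
  obtain ⟨N, hN⟩ := eventually_atTop.1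
    ((hlim.eventually_le_const one_pos).and (eventually_ge_atTop ⌈T⌉₊))
  set A : ℕ → Set (Fin d → ℝ) := fun t => {x ∈ Metric.ball x₀ r | ∃ u : Fin (n + 1) → ℤ, u ≠ 0 ∧
      ∀ i, |(gMat n t * uMat (f x)).mulVec (fun i => (u i : ℝ)) i| ≤ Real.exp (-γ * t)}
  set K : ℝ := C * (4 * ((n : ℝ) + 1)) ^ α
  have hbound : ∀ t, N ≤ t → volume (A t) ≤
      (2 * 48 ^ d) ^ n * volume (Metric.ball x₀ r) *
        ENNReal.ofReal (K * Real.exp (-(γ / 2) * α) ^ t) := by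
    intro t ht
    obtain ⟨h1, h2⟩ := hN t ht
    have hTt : T ≤ t := (Nat.le_ceil T).trans (by exact_mod_cast h2)
    have hsplit : Real.exp (-γ * t) = Real.exp (-(γ / 2) * t) * Real.exp (-(γ / 2) * t) := by
      rw [← Real.exp_add]; congr 1; ring
    have hle1 : Real.exp (-(γ / 2) * t) ≤ 1 := by
      rw [Real.exp_le_one_iff]
      have : 0 ≤ γ / 2 * t := by positivity
      linarith
    have hpos := Real.exp_pos (-(γ / 2) * (t : ℝ))
    have := volume_short_vector_le hn x₀ hr f hcont hgood t
      (ρ := Real.exp (-(γ / 2) * t) / 2) (ε := 2 * ((n : ℝ) + 1) * Real.exp (-γ * t))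
      (η := Real.exp (-γ * t)) (by linarith) (by positivity) (by rw [hsplit]; nlinarith)
      (fun j hj1 hj2 w hw => (half_lt_self hpos).trans_le (hT t hTt j hj1 hj2 w hw))
      (Real.exp_pos _).le (by
        have := mul_pos (show (0 : ℝ) < n + 1 by positivity) (Real.exp_pos (-γ * t))
        push_cast
        linarith)
    refine this.trans_eq ?_
    have hratio : 2 * ((n : ℝ) + 1) * Real.exp (-γ * t) / (Real.exp (-(γ / 2) * t) / 2) =
        4 * ((n : ℝ) + 1) * Real.exp (-(γ / 2) * t) := by
      rw [hsplit]; field_simp; ring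
    have hexp : Real.exp (-(γ / 2) * t * α) = Real.exp (-(γ / 2) * α) ^ t := by
      rw [← Real.exp_nat_mul]; congr 1; ring
    rw [hratio, Real.mul_rpow (by positivity) hpos.le, ← Real.exp_mul, hexp, ← mul_assoc,
      mul_right_comm]
  have hsum : ∑' t, volume (A (t + N)) ≠ ⊤ := by
    refine ne_top_of_le_ne_top ?_
      (ENNReal.tsum_le_tsum fun t => hbound (t + N) (Nat.le_add_left _ _))
    rw [ENNReal.tsum_mul_left]
    refine ENNReal.mul_ne_top (ENNReal.mul_ne_top ?_ measure_ball_lt_top.ne) ?_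
    · exact ENNReal.pow_ne_top (ENNReal.mul_ne_top (by simp) (ENNReal.pow_ne_top (by simp)))
    · have hlt : Real.exp (-(γ / 2) * α) < 1 := by
        rw [Real.exp_lt_one_iff]
        have : 0 < γ / 2 * α := by positivity
        linarith
      refine Summable.tsum_ofReal_ne_top (Summable.mul_left _ ?_)
      exact (summable_nat_add_iff N).2 (summable_geometric_of_lt_one (Real.exp_pos _).le hlt)
  refine measure_mono_null ?_
    (measure_setOfPred_frequently_eq_zero (p := fun t x => x ∈ A (t + N)) hsum)
  rintro x ⟨hx, hxT⟩
  refine frequently_atTop.2 fun T' => ?_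
  obtain ⟨t, ht, hu⟩ := hxT (T' + N)
  refine ⟨t - N, by omega, ?_⟩
  rw [Nat.sub_add_cancel (by omega)]
  exact ⟨hx, hu⟩

/-- **Lemma 3.6.** Let `B = B(x₀,r)` be a ball in `ℝ^d` and `f` a continuous map from
`3^{n+1}B` to `ℝ^n` such that (i) for some `C, α > 0` every linear combination of
`1, f₁, …, f_n` is `(C,α)`-good on `3^{n+1}B`, and (ii) condition [3.6-ii] holds for
`B` and `f`. Then `f(x)` is not VWA for a.e. `x ∈ B`. -/
theorem not_vwa_ae_of_good_and_cond36ii (d n : ℕ) (x₀ : Fin d → ℝ) (r : ℝ) (hr : 0 < r)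
    (f : (Fin d → ℝ) → Fin n → ℝ)
    (hcont : ContinuousOn f (Metric.ball x₀ ((3 : ℝ) ^ (n + 1) * r)))
    (C α : ℝ) (hC : 0 < C) (hα : 0 < α)
    (hgood : ∀ (c₀ : ℝ) (c : Fin n → ℝ),
      IsGoodOn C α (fun x => c₀ + ∑ i, c i * f x i)
        (Metric.ball x₀ ((3 : ℝ) ^ (n + 1) * r)))
    (h36 : Cond36ii (Metric.ball x₀ r) f) :
    volume {x ∈ Metric.ball x₀ r | IsVWA (f x)} = 0 := by
  rcases eq_or_ne n 0 with rfl | hn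
  · convert measure_empty (μ := (volume : Measure (Fin d → ℝ)))
    ext x
    simp only [Set.mem_ofPred_eq, Set.mem_empty_iff_false, iff_false, not_and]
    rintro - ⟨v, -, hv⟩
    exact hv (Set.toFinite _)
  · refine measure_mono_null ?_ (measure_iUnion_null fun m : ℕ =>
      volume_frequently_short_vector hn x₀ hr f hcont hα hgood h36
        (γ := 1 / ((m : ℝ) + 1)) (by positivity))
    rintro x ⟨hx, hvwa⟩
    obtain ⟨m, hm⟩ := hvwa.exists_short_vector hn
    exact Set.mem_iUnion.2 ⟨m, hx, hm⟩
end
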